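/- arXiv:2502.15364 — 3 statements merged into one kernel-verified Lean document; each statement's English description precedes it below -/
import Mathlib

section
/- Let 1/2 < σ_1 < 1 and A, B > 0 be fixed. Then for every sufficiently large T there exists T' ∈ [T, 2T] such that ζ(s) ≠ 0 for every s with Re(s) > 1/4 + σ_1/2 and |Im(s) − T'| ≤ 2 + (log T')^A + 2(log T')^B. -/
open Complex Filter

/-- The `n`-th term, shifted to start at `n = 0`, of a series for `(s - 1) ζ(s) - 1` that
converges on `0 < Re s`. -/
noncomputable def zetaCorrection (n : ℕ) (s : ℂ) : ℂ :=
  (s - 1) * ((n + 1 : ℕ) : ℂ) ^ (-s) - ((n + 1 : ℕ) : ℂ) ^ (1 - s) + ((n + 2 : ℕ) : ℂ) ^ (1 - s)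

lemma norm_ofReal_cpow_neg_sub_le {s : ℂ} (hs : 0 ≤ s.re) {x u : ℝ} (hx : 0 < x)
    (hu : u ∈ Set.Icc x (x + 1)) :
    ‖(u : ℂ) ^ (-s) - (x : ℂ) ^ (-s)‖ ≤ ‖s‖ * x ^ (-s.re - 1) := by
  rcases eq_or_ne s 0 with rfl | hs0
  · simp
  have h := norm_image_sub_le_of_norm_deriv_le_segment' (f := fun y : ℝ => (y : ℂ) ^ (-s))
    (f' := fun y : ℝ => -s * (y : ℂ) ^ (-s - 1)) (a := x) (b := x + 1)
    (C := ‖s‖ * x ^ (-s.re - 1)) ?_ ?_ u hu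
  · refine h.trans (mul_le_of_le_one_right (by positivity) (by linarith [hu.2]))
  · intro y hy
    exact (hasDerivAt_ofReal_cpow_const (hx.trans_le hy.1).ne' (neg_ne_zero.2 hs0)).hasDerivWithinAt
  · intro y hy
    rw [norm_mul, norm_neg, norm_cpow_eq_rpow_re_of_pos (show 0 < y by linarith [hy.1])]
    simp only [sub_re, neg_re, one_re]
    exact mul_le_mul_of_nonneg_left
      (Real.rpow_le_rpow_of_nonpos hx hy.1 (by linarith)) (norm_nonneg s)

lemma norm_zetaCorrection_le (n : ℕ) {s : ℂ} (hs : 0 ≤ s.re) :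
    ‖zetaCorrection n s‖ ≤ ‖s‖ * ‖s - 1‖ * ((n + 1 : ℕ) : ℝ) ^ (-s.re - 1) := by
  rcases eq_or_ne s 1 with rfl | hs1
  · simp [zetaCorrection]
  set x : ℝ := ((n + 1 : ℕ) : ℝ) with hx
  have hx0 : 0 < x := by positivity
  have h := norm_image_sub_le_of_norm_deriv_le_segment'
    (f := fun y : ℝ => (s - 1) * (x : ℂ) ^ (-s) * y + (y : ℂ) ^ (1 - s))
    (f' := fun y : ℝ => (s - 1) * (x : ℂ) ^ (-s) + (1 - s) * (y : ℂ) ^ (1 - s - 1))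
    (a := x) (b := x + 1)
    (C := ‖s‖ * ‖s - 1‖ * x ^ (-s.re - 1)) ?_ ?_ (x + 1) (by simp)
  · have e : ((n + 2 : ℕ) : ℂ) = ((x + 1 : ℝ) : ℂ) := by rw [hx]; push_cast; ring
    have e' : ((n + 1 : ℕ) : ℂ) = (x : ℂ) := by rw [hx]; push_cast; ring
    have e₂ : (s - 1) * (x : ℂ) ^ (-s) - (x : ℂ) ^ (1 - s) + ((x + 1 : ℝ) : ℂ) ^ (1 - s)
        = (s - 1) * (x : ℂ) ^ (-s) * ((x + 1 : ℝ) : ℂ) + ((x + 1 : ℝ) : ℂ) ^ (1 - s)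
          - ((s - 1) * (x : ℂ) ^ (-s) * x + (x : ℂ) ^ (1 - s)) := by
      generalize ((x + 1 : ℝ) : ℂ) ^ (1 - s) = a
      push_cast; ring
    rw [zetaCorrection, e, e', e₂]
    simpa using h
  · intro y hy
    have h1 := hasDerivAt_ofReal_cpow_const (hx0.trans_le hy.1).ne'
      (sub_ne_zero.2 hs1.symm)
    have h2 : HasDerivAt (fun y : ℝ => (s - 1) * (x : ℂ) ^ (-s) * y)
        ((s - 1) * (x : ℂ) ^ (-s)) y := by
      simpa using (ofRealCLM.hasDerivAt (x := y)).const_mul ((s - 1) * (x : ℂ) ^ (-s))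
    exact (h2.add h1).hasDerivWithinAt
  · intro y hy
    have e : (s - 1) * (x : ℂ) ^ (-s) + (1 - s) * (y : ℂ) ^ (1 - s - 1)
        = (1 - s) * ((y : ℂ) ^ (-s) - (x : ℂ) ^ (-s)) := by
      rw [show 1 - s - 1 = -s by ring]; ring
    rw [e, norm_mul, norm_sub_rev 1 s, mul_comm ‖s‖, mul_assoc]
    gcongr
    exact norm_ofReal_cpow_neg_sub_le hs hx0 (Set.Ico_subset_Icc_self hy)

lemma sum_range_zetaCorrection (M : ℕ) (s : ℂ) :
    ∑ n ∈ Finset.range M, zetaCorrection n s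
      = (s - 1) * ∑ n ∈ Finset.range M, ((n + 1 : ℕ) : ℂ) ^ (-s)
        + ((M + 1 : ℕ) : ℂ) ^ (1 - s) - 1 := by
  induction M with
  | zero => simp
  | succ M ih => rw [Finset.sum_range_succ, ih, Finset.sum_range_succ, zetaCorrection]; ring

lemma summable_natCast_succ_rpow {p : ℝ} (hp : p < -1) :
    Summable fun n : ℕ => ((n + 1 : ℕ) : ℝ) ^ p :=
  (summable_nat_add_iff 1).2 (Real.summable_nat_rpow.2 hp)

lemma summable_zetaCorrection {s : ℂ} (hs : 0 < s.re) :
    Summable fun n => zetaCorrection n s := by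
  refine Summable.of_norm_bounded (g := fun n : ℕ =>
    ‖s‖ * ‖s - 1‖ * ((n + 1 : ℕ) : ℝ) ^ (-s.re - 1)) ?_ fun n => norm_zetaCorrection_le n hs.le
  exact (summable_natCast_succ_rpow (by linarith)).mul_left _

lemma riemannZeta₁_eq_of_one_lt_re {s : ℂ} (hs : 1 < s.re) :
    riemannZeta₁ s = 1 + ∑' n, zetaCorrection n s := by
  have hs1 : s ≠ 1 := by rintro rfl; simp at hs
  have h1 : Tendsto (fun M : ℕ => ∑ n ∈ Finset.range M, zetaCorrection n s) atTop
      (nhds (∑' n, zetaCorrection n s)) :=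
    (summable_zetaCorrection (by linarith)).hasSum.tendsto_sum_nat
  have h2 : Tendsto (fun M : ℕ => ∑ n ∈ Finset.range M, zetaCorrection n s) atTop
      (nhds ((s - 1) * riemannZeta s + 0 - 1)) := by
    simp_rw [sum_range_zetaCorrection]
    refine ((Tendsto.const_mul _ ?_).add ?_).sub_const 1
    · rw [zeta_eq_tsum_one_div_nat_add_one_cpow hs]
      have : Summable fun n : ℕ => ((n + 1 : ℕ) : ℂ) ^ (-s) := by
        refine Summable.of_norm ?_
        simp_rw [norm_natCast_cpow_of_pos (Nat.succ_pos _)]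
        exact summable_natCast_succ_rpow (by simpa using hs)
      convert this.hasSum.tendsto_sum_nat using 2
      refine tsum_congr fun n => ?_
      rw [cpow_neg, one_div]; push_cast; rfl
    · rw [tendsto_zero_iff_norm_tendsto_zero]
      simp_rw [norm_natCast_cpow_of_pos (Nat.succ_pos _)]
      have := (tendsto_rpow_neg_atTop (y := s.re - 1) (by linarith)).comp
        (tendsto_natCast_atTop_atTop.comp (tendsto_add_atTop_nat 1))
      refine this.congr fun n => ?_
      simp
  have h3 := tendsto_nhds_unique h1 h2
  rw [h3, riemannZeta_eq_inv_sub_mul hs1]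
  have := sub_ne_zero.2 hs1
  field_simp
  ring

lemma riemannZeta₁_eq_of_re_pos {s : ℂ} (hs : 0 < s.re) :
    riemannZeta₁ s = 1 + ∑' n, zetaCorrection n s := by
  have hopen : IsOpen {s : ℂ | 0 < s.re} := isOpen_lt continuous_const continuous_re
  have hd : DifferentiableOn ℂ (fun s => 1 + ∑' n, zetaCorrection n s) {s : ℂ | 0 < s.re} := by
    refine DifferentiableOn.const_add _ ?_
    intro z hz
    have hz : 0 < z.re := hz
    set U : Set ℂ := {w | z.re / 2 < w.re} ∩ Metric.ball 0 (‖z‖ + 1)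
    have hU : IsOpen U :=
      (isOpen_lt continuous_const continuous_re).inter Metric.isOpen_ball
    have hzU : z ∈ U := ⟨by simpa using by linarith, by simp⟩
    have := differentiableOn_tsum_of_summable_norm (U := U) (F := zetaCorrection)
      (u := fun n : ℕ => (‖z‖ + 1) * (‖z‖ + 2) * ((n + 1 : ℕ) : ℝ) ^ (-(z.re / 2) - 1))
      ((summable_natCast_succ_rpow (by linarith)).mul_left _) ?_ hU ?_
    · exact (this.differentiableAt (hU.mem_nhds hzU)).differentiableWithinAt
    · intro n
      have h1 : ((n + 1 : ℕ) : ℂ) ≠ 0 := by exact_mod_cast Nat.succ_ne_zero n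
      have h2 : ((n + 2 : ℕ) : ℂ) ≠ 0 := by exact_mod_cast Nat.succ_ne_zero (n + 1)
      unfold zetaCorrection
      refine DifferentiableOn.add (DifferentiableOn.sub (DifferentiableOn.mul (by fun_prop) ?_) ?_) ?_
      · exact DifferentiableOn.const_cpow (by fun_prop) (.inl h1)
      · exact DifferentiableOn.const_cpow (by fun_prop) (.inl h1)
      · exact DifferentiableOn.const_cpow (by fun_prop) (.inl h2)
    · rintro n w ⟨hw1, hw2⟩
      have hw1 : z.re / 2 < w.re := hw1
      have hw2 : ‖w‖ < ‖z‖ + 1 := by simpa using hw2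
      refine (norm_zetaCorrection_le n (by linarith)).trans ?_
      gcongr
      · have := norm_sub_le w 1
        rw [norm_one] at this; linarith
      · exact_mod_cast Nat.succ_le_succ (Nat.zero_le n)
  have hconn : IsPreconnected {s : ℂ | 0 < s.re} :=
    (convex_halfSpace_re_gt 0).isPreconnected
  have hev : riemannZeta₁ =ᶠ[nhds (2 : ℂ)] fun s => 1 + ∑' n, zetaCorrection n s := by
    filter_upwards [(isOpen_lt continuous_const continuous_re).mem_nhds
      (show (2 : ℂ) ∈ {s : ℂ | 1 < s.re} by simp)] with s hs
    exact riemannZeta₁_eq_of_one_lt_re hs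
  exact (differentiable_riemannZeta₁.differentiableOn.analyticOnNhd
    hopen).eqOn_of_preconnected_of_eventuallyEq (hd.analyticOnNhd hopen) hconn
    (show (0:ℝ) < (2 : ℂ).re by simp) hev hs

/-- Truncating the Dirichlet series at a zero of `ζ`. -/
lemma exists_norm_partialSum_add_cpow_le {σ₀ η : ℝ} (hη : 0 < η) (hσ₀ : η < σ₀) :
    ∃ C : ℝ, 0 ≤ C ∧ ∀ s : ℂ, σ₀ ≤ s.re → riemannZeta s = 0 → ∀ M : ℕ,
      ‖(s - 1) * ∑ n ∈ Finset.range M, ((n + 1 : ℕ) : ℂ) ^ (-s) + ((M + 1 : ℕ) : ℂ) ^ (1 - s)‖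
        ≤ C * (‖s‖ * ‖s - 1‖ * ((M + 1 : ℕ) : ℝ) ^ (-σ₀ + η)) := by
  have hsum := summable_natCast_succ_rpow (p := -1 - η) (by linarith)
  refine ⟨∑' n : ℕ, ((n + 1 : ℕ) : ℝ) ^ (-1 - η), tsum_nonneg fun n => by positivity, ?_⟩
  intro s hs hz M
  have hs1 : s ≠ 1 := by rintro rfl; exact riemannZeta_one_ne_zero hz
  have hz1 : riemannZeta₁ s = 0 := by
    rw [riemannZeta_eq_inv_sub_mul hs1] at hz
    exact (mul_eq_zero.1 hz).resolve_left (inv_ne_zero (sub_ne_zero.2 hs1))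
  have hpos : 0 < s.re := by linarith
  rw [riemannZeta₁_eq_of_re_pos hpos] at hz1
  have hS := summable_zetaCorrection hpos
  have e : (s - 1) * ∑ n ∈ Finset.range M, ((n + 1 : ℕ) : ℂ) ^ (-s)
      + ((M + 1 : ℕ) : ℂ) ^ (1 - s) = - ∑' n, zetaCorrection (n + M) s := by
    have h1 := hS.sum_add_tsum_nat_add M
    rw [sum_range_zetaCorrection] at h1
    linear_combination h1 + hz1
  rw [e, norm_neg, ← tsum_mul_right]
  refine tsum_of_norm_bounded ((hsum.mul_right
    (‖s‖ * ‖s - 1‖ * ((M + 1 : ℕ) : ℝ) ^ (-σ₀ + η))).hasSum) fun n => ?_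
  refine (norm_zetaCorrection_le _ hpos.le).trans ?_
  rw [mul_left_comm]
  refine mul_le_mul_of_nonneg_left ?_ (by positivity)
  have h1 : (1 : ℝ) ≤ ((n + M + 1 : ℕ) : ℝ) := by exact_mod_cast Nat.succ_le_succ (Nat.zero_le _)
  calc ((n + M + 1 : ℕ) : ℝ) ^ (-s.re - 1) ≤ ((n + M + 1 : ℕ) : ℝ) ^ ((-1 - η) + (-σ₀ + η)) :=
        Real.rpow_le_rpow_of_exponent_le h1 (by linarith)
    _ = ((n + M + 1 : ℕ) : ℝ) ^ (-1 - η) * ((n + M + 1 : ℕ) : ℝ) ^ (-σ₀ + η) :=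
        Real.rpow_add (by linarith) _ _
    _ ≤ _ := by
        refine mul_le_mul ?_ ?_ (by positivity) (by positivity)
        · exact Real.rpow_le_rpow_of_nonpos (by positivity)
            (by exact_mod_cast (by omega : n + 1 ≤ n + M + 1)) (by linarith)
        · exact Real.rpow_le_rpow_of_nonpos (by positivity)
            (by exact_mod_cast (by omega : M + 1 ≤ n + M + 1)) (by linarith)

lemma inv_succ_le_log_succ_sub_log {n : ℕ} (hn : 1 ≤ n) :
    1 / ((n : ℝ) + 1) ≤ Real.log (n + 1) - Real.log n := by
  have hn' : (0 : ℝ) < n := by exact_mod_cast hn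
  rw [← Real.log_div (by positivity) hn'.ne']
  refine le_trans (le_of_eq ?_) (Real.one_sub_inv_le_log_of_pos (by positivity))
  field_simp
  ring

lemma log_succ_sub_log_le {n : ℕ} (hn : 1 ≤ n) :
    Real.log (n + 1) - Real.log n ≤ 1 / (n : ℝ) := by
  have hn' : (0 : ℝ) < n := by exact_mod_cast hn
  rw [← Real.log_div (by positivity) hn'.ne']
  refine (Real.log_le_sub_one_of_pos (by positivity)).trans (le_of_eq ?_)
  field_simp
  ring

lemma log_second_difference_nonneg {n : ℕ} (hn : 1 ≤ n) :
    Real.log (n + 2) - Real.log (n + 1) ≤ Real.log (n + 1) - Real.log n := by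
  have hn' : (0 : ℝ) < n := by exact_mod_cast hn
  rw [← Real.log_div (by positivity) (by positivity), ← Real.log_div (by positivity) hn'.ne']
  refine Real.log_le_log (by positivity) ?_
  rw [div_le_div_iff₀ (by positivity) hn']
  nlinarith

lemma log_second_difference_le {n : ℕ} (hn : 1 ≤ n) :
    (Real.log (n + 1) - Real.log n) - (Real.log (n + 2) - Real.log (n + 1))
      ≤ 1 / ((n : ℝ) * (n + 1)) := by
  have hn' : (0 : ℝ) < n := by exact_mod_cast hn
  rw [← Real.log_div (by positivity) hn'.ne', ← Real.log_div (by positivity) (by positivity),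
    ← Real.log_div (by positivity) (by positivity)]
  refine (Real.log_le_sub_one_of_pos (by positivity)).trans ?_
  rw [div_div_div_eq, div_sub_one (by positivity), div_le_div_iff₀ (by positivity) (by positivity)]
  nlinarith

lemma norm_one_sub_exp_neg_ge {z : ℂ} (hz : ‖z‖ ≤ 1 / 2) : ‖z‖ / 2 ≤ ‖1 - exp (-z)‖ := by
  have h := Complex.norm_exp_sub_one_sub_id_le (x := -z) (by rw [norm_neg]; linarith)
  have h2 : ‖z‖ ≤ ‖exp (-z) - 1 - -z‖ + ‖1 - exp (-z)‖ := by
    calc ‖z‖ = ‖(exp (-z) - 1 - -z) + (1 - exp (-z))‖ := by congr 1; ring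
      _ ≤ _ := norm_add_le _ _
  rw [norm_neg] at h
  nlinarith [norm_nonneg z]

lemma norm_exp_neg_mul_sub_le {s : ℂ} (hs : 0 ≤ s.re) {x y : ℝ} (hx : 0 ≤ x) (hxy : x ≤ y) :
    ‖exp (-s * y) - exp (-s * x)‖ ≤ ‖s‖ * (y - x) := by
  refine norm_image_sub_le_of_norm_deriv_le_segment' (f := fun u : ℝ => exp (-s * u))
    (f' := fun u : ℝ => exp (-s * u) * -s) (a := x) (b := y) ?_ ?_ y ⟨hxy, le_rfl⟩
  · intro u _
    have h : HasDerivAt (fun u : ℝ => -s * (u : ℂ)) (-s) u := by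
      simpa using (ofRealCLM.hasDerivAt (x := u)).const_mul (-s)
    exact h.cexp.hasDerivWithinAt
  · intro u hu
    rw [norm_mul, norm_neg, norm_exp]
    refine mul_le_of_le_one_left (norm_nonneg s) (Real.exp_le_one_iff.2 ?_)
    have : 0 ≤ s.re * u := mul_nonneg hs (hx.trans hu.1)
    simpa using this

lemma natCast_succ_cpow_neg {n : ℕ} (hn : 1 ≤ n) (s : ℂ) :
    ((n + 1 : ℕ) : ℂ) ^ (-s)
      = (n : ℂ) ^ (-s) * exp (-s * (Real.log (n + 1) - Real.log n : ℝ)) := by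
  have hn' : (n : ℂ) ≠ 0 := by exact_mod_cast (by omega : n ≠ 0)
  have hn'' : ((n + 1 : ℕ) : ℂ) ≠ 0 := by exact_mod_cast (by omega : n + 1 ≠ 0)
  rw [cpow_def_of_ne_zero hn', cpow_def_of_ne_zero hn'', ← exp_add]
  congr 1
  rw [ofReal_sub, ← natCast_log, show (Real.log ((n : ℝ) + 1)) = Real.log ((n + 1 : ℕ) : ℝ) by
    push_cast; rfl, ← natCast_log]
  ring

/-- A Kuzmin–Landau type bound, by partial summation against the almost geometric progression
`n ^ (-s)`. -/
lemma norm_sum_Ico_natCast_cpow_neg_le {s : ℂ} (hs : 0 ≤ s.re) (hs0 : s ≠ 0) {N M : ℕ}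
    (hN : 1 ≤ N) (hsN : 2 * ‖s‖ ≤ N) (hNM : N ≤ M) :
    ‖∑ n ∈ Finset.Ico N M, (n : ℂ) ^ (-s)‖ ≤
      4 / ‖s‖ * ((N : ℝ) ^ (1 - s.re) + (M : ℝ) ^ (1 - s.re))
        + 16 / ‖s‖ * ∑ n ∈ Finset.Ico N M, ((n + 1 : ℕ) : ℝ) ^ (-s.re) := by
  have hspos : 0 < ‖s‖ := norm_pos_iff.2 hs0
  set l : ℕ → ℝ := fun n => Real.log (n + 1) - Real.log n with hl
  set r : ℕ → ℂ := fun n => exp (-s * l n) with hr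
  set g : ℕ → ℂ := fun n => (1 - r n)⁻¹ with hg
  have hl_low : ∀ n, N ≤ n → 1 / (2 * (n : ℝ)) ≤ l n := fun n hn => by
    refine le_trans ?_ (inv_succ_le_log_succ_sub_log (hN.trans hn))
    have : (1 : ℝ) ≤ n := by exact_mod_cast hN.trans hn
    exact one_div_le_one_div_of_le (by linarith) (by linarith)
  have hl_pos : ∀ n, N ≤ n → 0 ≤ l n := fun n hn => le_trans (by positivity) (hl_low n hn)
  have hden : ∀ n, N ≤ n → ‖s‖ / (4 * n) ≤ ‖1 - r n‖ := fun n hn => by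
    have hn1 : (1 : ℝ) ≤ n := by exact_mod_cast hN.trans hn
    have hNn : (N : ℝ) ≤ n := by exact_mod_cast hn
    have hnorm : ‖s * (l n : ℂ)‖ = ‖s‖ * l n := by
      rw [norm_mul, norm_real, Real.norm_of_nonneg (hl_pos n hn)]
    have h1 : ‖s * (l n : ℂ)‖ ≤ 1 / 2 := by
      rw [hnorm]
      calc ‖s‖ * l n ≤ ‖s‖ * (1 / n) := by
            gcongr; exact log_succ_sub_log_le (hN.trans hn)
        _ ≤ 1 / 2 := by
            rw [mul_one_div, div_le_div_iff₀ (by linarith) (by norm_num)]; linarith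
    have h2 := norm_one_sub_exp_neg_ge h1
    rw [hnorm, ← neg_mul] at h2
    refine le_trans ?_ h2
    calc ‖s‖ / (4 * n) = ‖s‖ * (1 / (2 * n)) / 2 := by field_simp; norm_num
      _ ≤ _ := by gcongr; exact hl_low n hn
  have hne : ∀ n, N ≤ n → 1 - r n ≠ 0 := fun n hn => by
    have hn1 : (1 : ℝ) ≤ n := by exact_mod_cast hN.trans hn
    exact norm_pos_iff.1 (lt_of_lt_of_le (by positivity) (hden n hn))
  have hg_le : ∀ n, N ≤ n → ‖g n‖ ≤ 4 / ‖s‖ * n := fun n hn => by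
    have hn1 : (1 : ℝ) ≤ n := by exact_mod_cast hN.trans hn
    rw [hg, norm_inv]
    refine (inv_anti₀ (by positivity) (hden n hn)).trans (le_of_eq ?_)
    field_simp
  have hdg : ∀ n, N ≤ n → ‖g (n + 1) - g n‖ ≤ 16 / ‖s‖ := fun n hn => by
    have hn1 : (1 : ℝ) ≤ n := by exact_mod_cast hN.trans hn
    have e : g (n + 1) - g n = (r (n + 1) - r n) * g (n + 1) * g n := by
      have h1 := hne n hn
      have h2 := hne (n + 1) (by omega)
      simp only [hg]
      field_simp
      ring
    have hlsucc : l (n + 1) = Real.log (n + 2) - Real.log (n + 1) := by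
      simp only [hl]; push_cast; ring_nf
    have h3 : ‖r (n + 1) - r n‖ ≤ ‖s‖ * (1 / (n * (n + 1))) := by
      rw [norm_sub_rev]
      refine (norm_exp_neg_mul_sub_le hs (hl_pos (n + 1) (by omega)) ?_).trans ?_
      · rw [hlsucc]; exact log_second_difference_nonneg (hN.trans hn)
      · rw [hlsucc]; gcongr; exact log_second_difference_le (hN.trans hn)
    rw [e, norm_mul, norm_mul]
    calc ‖r (n + 1) - r n‖ * ‖g (n + 1)‖ * ‖g n‖
        ≤ (‖s‖ * (1 / (n * (n + 1)))) * (4 / ‖s‖ * ((n + 1 : ℕ) : ℝ)) * (4 / ‖s‖ * n) := by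
          gcongr
          · exact hg_le _ (by omega)
          · exact hg_le _ hn
      _ = 16 / ‖s‖ := by push_cast; field_simp; norm_num
  have hid : ∑ n ∈ Finset.Ico N M, (n : ℂ) ^ (-s)
      = (N : ℂ) ^ (-s) * g N - (M : ℂ) ^ (-s) * g M
        + ∑ n ∈ Finset.Ico N M, (g (n + 1) - g n) * ((n + 1 : ℕ) : ℂ) ^ (-s) := by
    induction M, hNM using Nat.le_induction with
    | base => simp
    | succ M hM ih =>
      rw [Finset.sum_Ico_succ_top hM, Finset.sum_Ico_succ_top hM, ih]
      have h1 : (M : ℂ) ^ (-s) * g M - ((M + 1 : ℕ) : ℂ) ^ (-s) * g M = (M : ℂ) ^ (-s) := by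
        have h2 : ((M + 1 : ℕ) : ℂ) ^ (-s) = (M : ℂ) ^ (-s) * r M :=
          natCast_succ_cpow_neg (hN.trans hM) s
        have h3 : (1 - r M) * g M = 1 := mul_inv_cancel₀ (hne M hM)
        rw [h2]
        linear_combination (M : ℂ) ^ (-s) * h3
      linear_combination -h1
  have hend : ∀ n, N ≤ n → ‖(n : ℂ) ^ (-s) * g n‖ ≤ 4 / ‖s‖ * (n : ℝ) ^ (1 - s.re) :=
    fun n hn => by
      have hn0 : 0 < n := by omega
      rw [norm_mul, norm_natCast_cpow_of_pos hn0, neg_re, sub_eq_add_neg,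
        Real.rpow_add (by exact_mod_cast hn0), Real.rpow_one, mul_comm]
      refine (mul_le_mul_of_nonneg_right (hg_le n hn) (by positivity)).trans (le_of_eq ?_)
      ring
  rw [hid, mul_add]
  refine (norm_add_le _ _).trans (add_le_add ?_ ?_)
  · exact (norm_sub_le _ _).trans (add_le_add (hend N le_rfl) (hend M hNM))
  · rw [Finset.mul_sum]
    refine norm_sum_le_of_le _ fun n hn => ?_
    rw [norm_mul, norm_natCast_cpow_of_pos (Nat.succ_pos n), neg_re]
    gcongr
    exact hdg n (Finset.mem_Ico.1 hn).1

lemma sum_Icc_rpow_neg_le {θ : ℝ} (hθ : 0 < θ) (hθ' : θ < 1) (Y : ℕ) :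
    ∑ n ∈ Finset.Icc 1 Y, (n : ℝ) ^ (-θ) ≤ (Y : ℝ) ^ (1 - θ) / (1 - θ) := by
  induction Y with
  | zero => simp; positivity
  | succ Y ih =>
    rw [Finset.sum_Icc_succ_top (by omega)]
    have hY : (0 : ℝ) < (Y : ℝ) + 1 := by positivity
    have h := rpow_one_add_le_one_add_mul_self (s := -(1 / ((Y : ℝ) + 1))) (p := 1 - θ)
      (by rw [neg_le_neg_iff, div_le_one hY]; linarith [(Nat.cast_nonneg Y : (0 : ℝ) ≤ Y)])
      (by linarith) (by linarith)
    have e : 1 + -(1 / ((Y : ℝ) + 1)) = Y / (Y + 1) := by field_simp; ring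
    rw [e, Real.div_rpow (by positivity) hY.le, div_le_iff₀ (by positivity)] at h
    have e2 : ((Y : ℝ) + 1) ^ (1 - θ) = (Y + 1) * ((Y : ℝ) + 1) ^ (-θ) := by
      rw [sub_eq_add_neg, Real.rpow_add hY, Real.rpow_one]
    have h1θ : 0 < 1 - θ := by linarith
    rw [le_div_iff₀ h1θ] at ih ⊢
    have e3 : (1 + (1 - θ) * -(1 / ((Y : ℝ) + 1))) * ((Y : ℝ) + 1) ^ (1 - θ)
        = ((Y : ℝ) + 1) ^ (1 - θ) - (1 - θ) * ((Y : ℝ) + 1) ^ (-θ) := by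
      rw [e2]; field_simp; ring
    rw [e3] at h
    push_cast
    linarith


lemma rpow_one_add_of_pos {x : ℝ} (hx : 0 < x) (y : ℝ) : x ^ (1 + y) = x * x ^ y := by
  rw [Real.rpow_add hx, Real.rpow_one]

lemma exists_norm_sum_Ico_natCast_cpow_neg_le_of_zero {σ₀ η : ℝ} (hη : 0 < η) (hησ : η < σ₀)
    (hσ₀ : σ₀ < 1) :
    ∃ C : ℝ, 0 ≤ C ∧ ∀ s : ℂ, σ₀ ≤ s.re → riemannZeta s = 0 → ∀ N : ℕ, 1 ≤ N →
      2 * ‖s‖ ≤ N → N ≤ 8 * ‖s‖ → N ≤ 8 * ‖s - 1‖ →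
      ‖∑ n ∈ Finset.Ico 1 N, (n : ℂ) ^ (-s)‖ ≤ C * (N : ℝ) ^ (1 - 2 * σ₀ + 2 * η) := by
  obtain ⟨C₁, hC₁, H⟩ := exists_norm_partialSum_add_cpow_le hη hησ
  have h1σ : 0 < 1 - σ₀ := by linarith
  refine ⟨C₁ + 8 + (64 + 128 / (1 - σ₀)), by positivity, ?_⟩
  intro s hs hz N hN h2 h8 h8'
  have hN1 : (1 : ℝ) ≤ N := by exact_mod_cast hN
  have hN0 : (0 : ℝ) < N := by linarith
  have hspos : 0 < ‖s‖ := by linarith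
  have hspos' : 0 < ‖s - 1‖ := by linarith
  have hNN : N ≤ N ^ 2 := Nat.le_self_pow two_ne_zero N
  have hN2 : 1 ≤ N ^ 2 := hN.trans hNN
  have hsq : ∀ p : ℝ, ((N ^ 2 : ℕ) : ℝ) ^ p = (N : ℝ) ^ (2 * p) := fun p => by
    rw [Nat.cast_pow, ← Real.rpow_natCast, ← Real.rpow_mul hN0.le]; norm_num
  set E : ℝ := (N : ℝ) ^ (1 - 2 * σ₀ + 2 * η) with hE
  have hE1 : (N : ℝ) * (N : ℝ) ^ (2 * (-σ₀ + η)) = E := by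
    rw [← rpow_one_add_of_pos hN0, hE]; congr 1; ring
  have hE2 : (N : ℝ) ^ (2 * (1 - σ₀)) ≤ N * E := by
    rw [← rpow_one_add_of_pos hN0]
    exact Real.rpow_le_rpow_of_exponent_le hN1 (by linarith)
  have hdiv : ∀ {x y : ℝ}, 0 < x → (N : ℝ) ≤ 8 * x → 0 ≤ y → y ≤ N * E → y / x ≤ 8 * E := by
    intro x y hx hNx hy hyE
    rw [div_le_iff₀ hx]
    have : 0 ≤ E := by positivity
    nlinarith
  have hlong : ‖∑ n ∈ Finset.Ico 1 (N ^ 2), (n : ℂ) ^ (-s)‖ ≤ (C₁ + 8) * E := by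
    have h := H s hs hz (N ^ 2 - 1)
    rw [Nat.sub_add_cancel hN2, hsq] at h
    have e : ∑ n ∈ Finset.range (N ^ 2 - 1), ((n + 1 : ℕ) : ℂ) ^ (-s)
        = ∑ n ∈ Finset.Ico 1 (N ^ 2), (n : ℂ) ^ (-s) := by
      rw [Finset.sum_Ico_eq_sum_range]
      simp_rw [add_comm 1]
    rw [e] at h
    set A := ∑ n ∈ Finset.Ico 1 (N ^ 2), (n : ℂ) ^ (-s)
    have h1 : ‖s - 1‖ * ‖A‖ ≤ C₁ * (‖s‖ * ‖s - 1‖ * (N : ℝ) ^ (2 * (-σ₀ + η)))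
        + ((N ^ 2 : ℕ) : ℝ) ^ (1 - s.re) := by
      rw [← norm_mul]
      calc ‖(s - 1) * A‖ = ‖((s - 1) * A + ((N ^ 2 : ℕ) : ℂ) ^ (1 - s))
            - ((N ^ 2 : ℕ) : ℂ) ^ (1 - s)‖ := by rw [add_sub_cancel_right]
        _ ≤ _ := (norm_sub_le _ _).trans (add_le_add h (by
            rw [norm_natCast_cpow_of_pos (by omega)]; simp))
    have h2' : ((N ^ 2 : ℕ) : ℝ) ^ (1 - s.re) ≤ N * E := by
      rw [hsq]
      exact (Real.rpow_le_rpow_of_exponent_le hN1 (by linarith)).trans hE2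
    have h3 := hdiv hspos' h8' (by positivity) h2'
    have h4 : ‖s‖ * (N : ℝ) ^ (2 * (-σ₀ + η)) ≤ E := by
      rw [← hE1]; gcongr; linarith
    calc ‖A‖ = ‖s - 1‖ * ‖A‖ / ‖s - 1‖ := by field_simp
      _ ≤ (C₁ * (‖s‖ * ‖s - 1‖ * (N : ℝ) ^ (2 * (-σ₀ + η)))
        + ((N ^ 2 : ℕ) : ℝ) ^ (1 - s.re)) / ‖s - 1‖ := by gcongr
      _ = C₁ * (‖s‖ * (N : ℝ) ^ (2 * (-σ₀ + η)))
        + ((N ^ 2 : ℕ) : ℝ) ^ (1 - s.re) / ‖s - 1‖ := by field_simp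
      _ ≤ C₁ * E + 8 * E := by gcongr
      _ = _ := by ring
  have hshort : ‖∑ n ∈ Finset.Ico N (N ^ 2), (n : ℂ) ^ (-s)‖ ≤ (64 + 128 / (1 - σ₀)) * E := by
    refine (norm_sum_Ico_natCast_cpow_neg_le (by linarith) (norm_pos_iff.1 hspos) hN h2 hNN).trans ?_
    have e1 : (N : ℝ) ^ (1 - s.re) ≤ N * E :=
      (Real.rpow_le_rpow_of_exponent_le hN1 (by linarith)).trans hE2
    have e2 : ((N ^ 2 : ℕ) : ℝ) ^ (1 - s.re) ≤ N * E := by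
      rw [hsq]
      exact (Real.rpow_le_rpow_of_exponent_le hN1 (by linarith)).trans hE2
    have e3 : ∑ n ∈ Finset.Ico N (N ^ 2), ((n + 1 : ℕ) : ℝ) ^ (-s.re)
        ≤ (N : ℝ) ^ (2 * (1 - σ₀)) / (1 - σ₀) := by
      rw [← hsq]
      refine le_trans ?_ (sum_Icc_rpow_neg_le (by linarith) hσ₀ (N ^ 2))
      rw [Finset.sum_Ico_add' (fun n : ℕ => (n : ℝ) ^ (-s.re)) N (N ^ 2) 1]
      refine (Finset.sum_le_sum_of_subset_of_nonneg (t := Finset.Icc 1 (N ^ 2)) ?_ ?_).trans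
        (Finset.sum_le_sum fun n hn => ?_)
      · intro n hn
        simp only [Finset.mem_Ico, Finset.mem_Icc] at hn ⊢
        omega
      · intros; positivity
      · exact Real.rpow_le_rpow_of_exponent_le (by exact_mod_cast (Finset.mem_Icc.1 hn).1)
          (by linarith)
    have f1 := hdiv hspos h8 (by positivity) e1
    have f2 := hdiv hspos h8 (by positivity) e2
    have f3 := hdiv hspos h8 (by positivity) hE2
    calc 4 / ‖s‖ * ((N : ℝ) ^ (1 - s.re) + ((N ^ 2 : ℕ) : ℝ) ^ (1 - s.re))
          + 16 / ‖s‖ * ∑ n ∈ Finset.Ico N (N ^ 2), ((n + 1 : ℕ) : ℝ) ^ (-s.re)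
        ≤ 4 / ‖s‖ * ((N : ℝ) ^ (1 - s.re) + ((N ^ 2 : ℕ) : ℝ) ^ (1 - s.re))
          + 16 / ‖s‖ * ((N : ℝ) ^ (2 * (1 - σ₀)) / (1 - σ₀)) := by gcongr
      _ = 4 * ((N : ℝ) ^ (1 - s.re) / ‖s‖) + 4 * (((N ^ 2 : ℕ) : ℝ) ^ (1 - s.re) / ‖s‖)
          + 16 * ((N : ℝ) ^ (2 * (1 - σ₀)) / ‖s‖) / (1 - σ₀) := by field_simp
      _ ≤ 4 * (8 * E) + 4 * (8 * E) + 16 * (8 * E) / (1 - σ₀) := by gcongr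
      _ = _ := by ring
  have hsplit := Finset.sum_Ico_consecutive (fun n : ℕ => (n : ℂ) ^ (-s)) hN hNN
  rw [eq_sub_of_add_eq hsplit]
  refine (norm_sub_le _ _).trans ((add_le_add hlong hshort).trans (le_of_eq ?_))
  ring

lemma exists_succ_le_mul_two_rpow {ε : ℝ} (hε : 0 < ε) :
    ∃ K : ℝ, 1 ≤ K ∧ ∀ a : ℕ, (a : ℝ) + 1 ≤ K * (2 : ℝ) ^ (ε * a) := by
  have hlog : 0 < Real.log 2 := Real.log_pos (by norm_num)
  refine ⟨1 + 1 / (ε * Real.log 2), le_add_of_nonneg_right (by positivity), fun a => ?_⟩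
  have h1 : 1 + ε * Real.log 2 * a ≤ (2 : ℝ) ^ (ε * a) := by
    rw [Real.rpow_def_of_pos (by norm_num)]
    have := Real.add_one_le_exp (Real.log 2 * (ε * a))
    linarith
  calc (a : ℝ) + 1 ≤ (1 + 1 / (ε * Real.log 2)) * (1 + ε * Real.log 2 * a) := by
        have : (1 + 1 / (ε * Real.log 2)) * (1 + ε * Real.log 2 * a)
          = 1 + a + (1 / (ε * Real.log 2) + ε * Real.log 2 * a) := by field_simp; ring
        rw [this]
        have : 0 ≤ 1 / (ε * Real.log 2) + ε * Real.log 2 * a := by positivity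
        linarith
    _ ≤ _ := by gcongr

/-- The divisor bound. -/
lemma exists_card_divisors_le {ε : ℝ} (hε : 0 < ε) :
    ∃ C : ℝ, 0 < C ∧ ∀ n : ℕ, 1 ≤ n → (n.divisors.card : ℝ) ≤ C * (n : ℝ) ^ ε := by
  obtain ⟨K, hK1, hK⟩ := exists_succ_le_mul_two_rpow hε
  set P : ℕ := ⌈(2 : ℝ) ^ (1 / ε)⌉₊ with hP
  refine ⟨K ^ P, by positivity, fun n hn => ?_⟩
  have hn0 : n ≠ 0 := by omega
  have hlocal : ∀ p ∈ n.primeFactors, ((n.factorization p : ℝ) + 1)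
      ≤ (if p < P then K else 1) * ((p : ℝ) ^ n.factorization p) ^ ε := by
    intro p hp
    have hp2 : (2 : ℝ) ≤ p := by exact_mod_cast (Nat.prime_of_mem_primeFactors hp).two_le
    have hpow : ((p : ℝ) ^ n.factorization p) ^ ε = (p : ℝ) ^ (ε * n.factorization p) := by
      rw [← Real.rpow_natCast, ← Real.rpow_mul (by linarith), mul_comm]
    rw [hpow]
    split_ifs with h
    · refine (hK _).trans ?_
      gcongr
    · have hge : (2 : ℝ) ^ (1 / ε) ≤ p := (Nat.le_ceil _).trans (by exact_mod_cast not_lt.1 h)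
      have h2 : (2 : ℝ) ≤ (p : ℝ) ^ ε := by
        calc (2 : ℝ) = ((2 : ℝ) ^ (1 / ε)) ^ ε := by
              rw [← Real.rpow_mul (by norm_num), one_div_mul_cancel hε.ne', Real.rpow_one]
          _ ≤ _ := by gcongr
      rw [one_mul, Real.rpow_mul (by linarith), Real.rpow_natCast]
      calc ((n.factorization p : ℝ) + 1) ≤ (2 : ℝ) ^ n.factorization p := by
            exact_mod_cast Nat.lt_two_pow_self
        _ ≤ _ := by gcongr
  have hprod : ∏ p ∈ n.primeFactors, ((p : ℝ) ^ n.factorization p) ^ ε = (n : ℝ) ^ ε := by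
    rw [Real.finsetProd_rpow _ _ fun p _ => by positivity]
    congr 1
    have := Nat.prod_factorization_pow_eq_self hn0
    rw [Finsupp.prod, Nat.support_factorization] at this
    exact_mod_cast this
  rw [Nat.card_divisors hn0]
  push_cast
  calc ∏ p ∈ n.primeFactors, ((n.factorization p : ℝ) + 1)
      ≤ ∏ p ∈ n.primeFactors, (if p < P then K else 1) * ((p : ℝ) ^ n.factorization p) ^ ε :=
        Finset.prod_le_prod (fun p _ => by positivity) hlocal
    _ = (∏ p ∈ n.primeFactors, if p < P then K else 1) * (n : ℝ) ^ ε := by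
        rw [Finset.prod_mul_distrib, hprod]
    _ ≤ K ^ P * (n : ℝ) ^ ε := by
        gcongr
        rw [Finset.prod_ite, Finset.prod_const, Finset.prod_const_one, mul_one]
        refine pow_le_pow_right₀ hK1 ?_
        calc _ ≤ (Finset.range P).card := Finset.card_le_card fun p hp => by
              simpa using (Finset.mem_filter.1 hp).2
          _ = P := Finset.card_range P

lemma exists_card_divisors_mul_log_pow_le {η : ℝ} (hη : 0 < η) (hη1 : η ≤ 1) :
    ∃ A : ℝ, 0 < A ∧ ∀ n : ℕ, 1 ≤ n → ∀ k ≤ 2,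
      (n.divisors.card : ℝ) * Real.log n ^ k ≤ A * (n : ℝ) ^ η := by
  obtain ⟨C, hC, H⟩ := exists_card_divisors_le (half_pos hη)
  refine ⟨C * (4 / η) ^ 2, by positivity, fun n hn k hk => ?_⟩
  have hn1 : (1 : ℝ) ≤ n := by exact_mod_cast hn
  have hlog := Real.log_le_rpow_div (x := n) (by linarith) (show 0 < η / 4 by linarith)
  have hbase : 1 ≤ (n : ℝ) ^ (η / 4) / (η / 4) := by
    rw [le_div_iff₀ (by linarith)]
    have := Real.one_le_rpow hn1 (show 0 ≤ η / 4 by linarith)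
    linarith
  calc (n.divisors.card : ℝ) * Real.log n ^ k
      ≤ (C * (n : ℝ) ^ (η / 2)) * ((n : ℝ) ^ (η / 4) / (η / 4)) ^ 2 := by
        refine mul_le_mul (H n hn) ?_ (pow_nonneg (Real.log_nonneg hn1) k) (by positivity)
        exact (pow_le_pow_left₀ (Real.log_nonneg hn1) hlog k).trans (pow_le_pow_right₀ hbase hk)
    _ = C * (4 / η) ^ 2 * ((n : ℝ) ^ (η / 2) * ((n : ℝ) ^ (η / 4)) ^ 2) := by field_simp
    _ = C * (4 / η) ^ 2 * (n : ℝ) ^ η := by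
        rw [← Real.rpow_mul_natCast (by linarith), ← Real.rpow_add (by linarith)]
        congr 2
        push_cast; ring

/-- The Dirichlet coefficients of the product of `∑_{m < N} m⁻ˢ` and `∑_{d ≤ X} μ(d) d⁻ˢ`. -/
def mollifiedCoeff (N X n : ℕ) : ℤ :=
  ∑ p ∈ n.divisorsAntidiagonal with p.1 < N ∧ p.2 ≤ X, ArithmeticFunction.moebius p.2

lemma abs_mollifiedCoeff_le (N X n : ℕ) : |mollifiedCoeff N X n| ≤ n.divisors.card := by
  calc |mollifiedCoeff N X n|
      ≤ ∑ p ∈ n.divisorsAntidiagonal with p.1 < N ∧ p.2 ≤ X, |ArithmeticFunction.moebius p.2| :=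
        Finset.abs_sum_le_sum_abs _ _
    _ ≤ ∑ p ∈ n.divisorsAntidiagonal with p.1 < N ∧ p.2 ≤ X, 1 :=
        Finset.sum_le_sum fun p _ => ArithmeticFunction.abs_moebius_le_one
    _ ≤ n.divisors.card := by
        rw [Finset.sum_const, nsmul_one]
        refine Nat.cast_le.2 ((Finset.card_filter_le _ _).trans_eq ?_)
        rw [← Nat.map_div_right_divisors, Finset.card_map]

lemma mollifiedCoeff_of_le {N X n : ℕ} (hX : n ≤ X) (hN : n < N) :
    mollifiedCoeff N X n = if n = 1 then 1 else 0 := by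
  have h : mollifiedCoeff N X n
      = ∑ p ∈ n.divisorsAntidiagonal, ArithmeticFunction.moebius p.2 := by
    rw [mollifiedCoeff, Finset.filter_true_of_mem]
    intro p hp
    obtain ⟨hpn, hn⟩ := Nat.mem_divisorsAntidiagonal.1 hp
    have h1 := Nat.le_of_dvd (by omega) (Dvd.intro _ hpn)
    have h2 := Nat.le_of_dvd (by omega) (Dvd.intro_left _ hpn)
    omega
  have h2 := DFunLike.congr_fun ArithmeticFunction.coe_zeta_mul_moebius n
  rw [ArithmeticFunction.coe_zeta_mul_apply, ArithmeticFunction.one_apply] at h2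
  rw [h, ← h2, Nat.sum_divisorsAntidiagonal' (f := fun _ d => ArithmeticFunction.moebius d)]

lemma sum_mul_sum_moebius_eq {N X : ℕ} (hX : 1 ≤ X) (hXN : X < N) (s : ℂ) :
    (∑ m ∈ Finset.Ico 1 N, (m : ℂ) ^ (-s))
        * ∑ d ∈ Finset.Icc 1 X, (ArithmeticFunction.moebius d : ℂ) * (d : ℂ) ^ (-s)
      = 1 + ∑ n ∈ Finset.Ioc X (N * X), (mollifiedCoeff N X n : ℂ) * (n : ℂ) ^ (-s) := by
  have h1 : (∑ m ∈ Finset.Ico 1 N, (m : ℂ) ^ (-s))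
        * ∑ d ∈ Finset.Icc 1 X, (ArithmeticFunction.moebius d : ℂ) * (d : ℂ) ^ (-s)
      = ∑ n ∈ Finset.Icc 1 (N * X), (mollifiedCoeff N X n : ℂ) * (n : ℂ) ^ (-s) := by
    rw [Finset.sum_mul_sum, ← Finset.sum_product',
      ← Finset.sum_fiberwise_of_maps_to (g := fun p : ℕ × ℕ => p.1 * p.2)
        (t := Finset.Icc 1 (N * X))]
    · refine Finset.sum_congr rfl fun n hn => ?_
      have hn := Finset.mem_Icc.1 hn
      have hset : {p ∈ Finset.Ico 1 N ×ˢ Finset.Icc 1 X | p.1 * p.2 = n}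
          = {p ∈ n.divisorsAntidiagonal | p.1 < N ∧ p.2 ≤ X} := by
        ext ⟨a, b⟩
        simp only [Finset.mem_filter, Finset.mem_product, Finset.mem_Ico, Finset.mem_Icc,
          Nat.mem_divisorsAntidiagonal]
        constructor
        · rintro ⟨⟨⟨ha, ha'⟩, hb, hb'⟩, h⟩
          exact ⟨⟨h, by omega⟩, ha', hb'⟩
        · rintro ⟨⟨h, h0⟩, ha', hb'⟩
          have ha : a ≠ 0 := by rintro rfl; simp at h; omega
          have hb : b ≠ 0 := by rintro rfl; simp at h; omega
          exact ⟨⟨⟨by omega, ha'⟩, by omega, hb'⟩, h⟩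
      rw [hset, mollifiedCoeff, Int.cast_sum, Finset.sum_mul]
      refine Finset.sum_congr rfl fun p hp => ?_
      have hpn := (Nat.mem_divisorsAntidiagonal.1 (Finset.mem_filter.1 hp).1).1
      rw [← hpn, Nat.cast_mul, natCast_mul_natCast_cpow]
      ring
    · rintro ⟨a, b⟩ hp
      simp only [Finset.mem_product, Finset.mem_Ico, Finset.mem_Icc] at hp ⊢
      exact ⟨Nat.mul_pos hp.1.1 hp.2.1, Nat.mul_le_mul hp.1.2.le hp.2.2⟩
  have hXNX : X ≤ N * X := Nat.le_mul_of_pos_left X (by omega)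
  have h2 : ∑ n ∈ Finset.Icc 1 X, (mollifiedCoeff N X n : ℂ) * (n : ℂ) ^ (-s) = 1 := by
    rw [Finset.sum_eq_single_of_mem 1 (by simpa using hX)]
    · simp [mollifiedCoeff_of_le hX (by omega : 1 < N)]
    · intro n hn hn1
      have hn := (Finset.mem_Icc.1 hn).2
      simp [mollifiedCoeff_of_le hn (by omega : n < N), hn1]
  rw [h1, ← h2]
  exact (Finset.sum_Ioc_consecutive (fun n => (mollifiedCoeff N X n : ℂ) * (n : ℂ) ^ (-s))
    (Nat.zero_le X) hXNX).symm

lemma norm_integral_exp_mul_I_le {u : ℝ} (hu : u ≠ 0) (a b : ℝ) :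
    ‖∫ t in a..b, exp (I * u * t)‖ ≤ 2 / |u| := by
  have hc : I * (u : ℂ) ≠ 0 := mul_ne_zero I_ne_zero (by exact_mod_cast hu)
  have h1 : ∀ t : ℝ, ‖exp (I * u * t)‖ = 1 := fun t => by
    rw [norm_exp]; simp
  rw [integral_exp_mul_complex hc, norm_div, norm_mul, norm_I, one_mul, norm_real, Real.norm_eq_abs]
  gcongr
  refine (norm_sub_le _ _).trans ?_
  rw [h1, h1]; norm_num

lemma integral_norm_sq_sum_exp_le {ι : Type*} [DecidableEq ι] (S : Finset ι) (c : ι → ℂ)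
    (l : ι → ℝ) (hl : Set.InjOn l S) {a b : ℝ} (hab : a ≤ b) :
    ∫ t in a..b, ‖∑ n ∈ S, c n * exp (I * l n * t)‖ ^ 2 ≤
      (b - a) * ∑ n ∈ S, ‖c n‖ ^ 2
        + ∑ m ∈ S, ∑ n ∈ S.erase m, ‖c m‖ * ‖c n‖ * (2 / |l m - l n|) := by
  have hexp : ∀ t : ℝ, ((‖∑ n ∈ S, c n * exp (I * l n * t)‖ ^ 2 : ℝ) : ℂ)
      = ∑ m ∈ S, ∑ n ∈ S, c m * (starRingEnd ℂ) (c n) * exp (I * (l m - l n : ℝ) * t) := by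
    intro t
    rw [← normSq_eq_norm_sq, ← mul_conj, map_sum, Finset.sum_mul_sum]
    refine Finset.sum_congr rfl fun m _ => Finset.sum_congr rfl fun n _ => ?_
    have e : exp (I * (l m - l n : ℝ) * t) = exp (I * l m * t) * exp (-(I * l n * t)) := by
      rw [← exp_add]; congr 1; push_cast; ring
    rw [map_mul, ← exp_conj, e]
    simp only [map_mul, conj_I, conj_ofReal, neg_mul]
    ring
  have hint : ((∫ t in a..b, ‖∑ n ∈ S, c n * exp (I * l n * t)‖ ^ 2 : ℝ) : ℂ)
      = ∑ m ∈ S, ∑ n ∈ S, c m * (starRingEnd ℂ) (c n)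
          * ∫ t in a..b, exp (I * (l m - l n : ℝ) * t) := by
    rw [← intervalIntegral.integral_ofReal]
    simp_rw [hexp]
    rw [intervalIntegral.integral_finsetSum]
    · refine Finset.sum_congr rfl fun m _ => ?_
      rw [intervalIntegral.integral_finsetSum]
      · refine Finset.sum_congr rfl fun n _ => ?_
        rw [intervalIntegral.integral_const_mul]
      · intro n _
        exact Continuous.intervalIntegrable (by fun_prop) _ _
    · intro m _
      exact Continuous.intervalIntegrable (by fun_prop) _ _
  have hre : ∫ t in a..b, ‖∑ n ∈ S, c n * exp (I * l n * t)‖ ^ 2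
      ≤ ‖((∫ t in a..b, ‖∑ n ∈ S, c n * exp (I * l n * t)‖ ^ 2 : ℝ) : ℂ)‖ := by
    rw [norm_real]; exact Real.le_norm_self _
  refine hre.trans ?_
  rw [hint, Finset.mul_sum, ← Finset.sum_add_distrib]
  refine norm_sum_le_of_le _ fun m hm => ?_
  rw [← Finset.add_sum_erase S _ hm]
  refine (norm_add_le _ _).trans (add_le_add ?_ (norm_sum_le_of_le _ fun n hn => ?_))
  · rw [norm_mul, norm_mul, RCLike.norm_conj]
    simp only [sub_self, ofReal_zero, mul_zero, zero_mul, exp_zero,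
      intervalIntegral.integral_const]
    rw [norm_smul, norm_one, mul_one, Real.norm_of_nonneg (by linarith)]
    exact le_of_eq (by ring)
  · rw [norm_mul, norm_mul, RCLike.norm_conj]
    gcongr
    refine norm_integral_exp_mul_I_le (sub_ne_zero.2 fun h => ?_) a b
    exact Finset.ne_of_mem_erase hn (hl (Finset.mem_of_mem_erase hn) hm h.symm)

lemma inv_abs_log_sub_log_le {x y : ℝ} (hx : 0 < x) (hy : 0 < y) (hxy : x ≠ y) :
    1 / |Real.log x - Real.log y| ≤ max x y / |x - y| := by
  wlog h : y < x generalizing x y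
  · rw [abs_sub_comm (Real.log x), abs_sub_comm x, max_comm]
    exact this hy hx hxy.symm (lt_of_le_of_ne (not_lt.1 h) hxy)
  have hsub : 0 < x - y := by linarith
  have h1 : (x - y) / x ≤ Real.log x - Real.log y := by
    rw [← Real.log_div hx.ne' hy.ne']
    refine le_trans (le_of_eq ?_) (Real.one_sub_inv_le_log_of_pos (by positivity))
    field_simp
  have h2 : 0 < (x - y) / x := by positivity
  rw [abs_of_pos (h2.trans_le h1), abs_of_pos hsub, max_eq_left h.le]
  calc 1 / (Real.log x - Real.log y) ≤ 1 / ((x - y) / x) := one_div_le_one_div_of_le h2 h1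
    _ = x / (x - y) := by rw [one_div_div]

lemma rpow_mul_rpow_div_abs_log_le {θ x y : ℝ} (hθ : 0 ≤ θ) (hθ' : θ ≤ 1) (hx : 0 < x)
    (hy : 0 < y) (hxy : x ≠ y) :
    x ^ (-θ) * y ^ (-θ) * (1 / |Real.log x - Real.log y|)
      ≤ x ^ (-θ) * y ^ (-θ) + x ^ (1 - 2 * θ) * (1 / |x - y|) := by
  have hd : 0 < |x - y| := abs_pos.2 (sub_ne_zero.2 hxy)
  have hmax : max x y / |x - y| = 1 + min x y * (1 / |x - y|) := by
    have e : |x - y| = max x y - min x y := by rw [max_comm, min_comm, max_sub_min_eq_abs]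
    rw [mul_one_div, eq_comm, eq_div_iff hd.ne', add_mul, div_mul_cancel₀ _ hd.ne', e]
    ring
  have key : x ^ (-θ) * y ^ (-θ) * min x y ≤ x ^ (1 - 2 * θ) := by
    have e1 : x ^ (1 - 2 * θ) = x ^ (-θ) * x ^ (1 - θ) := by
      rw [← Real.rpow_add hx]; congr 1; ring
    have e2 : ∀ {z : ℝ}, 0 < z → z ^ (1 - θ) = z ^ (-θ) * z := fun {z} hz => by
      rw [sub_eq_neg_add, Real.rpow_add hz, Real.rpow_one]
    rw [e1, mul_assoc]
    refine mul_le_mul_of_nonneg_left ?_ (by positivity)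
    rcases le_total x y with h | h
    · rw [min_eq_left h, e2 hx]
      exact mul_le_mul_of_nonneg_right
        (Real.rpow_le_rpow_of_nonpos hx h (by linarith)) hx.le
    · rw [min_eq_right h, ← e2 hy]
      exact Real.rpow_le_rpow hy.le h (by linarith)
  calc x ^ (-θ) * y ^ (-θ) * (1 / |Real.log x - Real.log y|)
      ≤ x ^ (-θ) * y ^ (-θ) * (max x y / |x - y|) := by
        exact mul_le_mul_of_nonneg_left (inv_abs_log_sub_log_le hx hy hxy) (by positivity)
    _ = x ^ (-θ) * y ^ (-θ) + x ^ (-θ) * y ^ (-θ) * min x y * (1 / |x - y|) := by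
        rw [hmax]; ring
    _ ≤ _ := by gcongr

lemma sum_Icc_one_div_le (Y : ℕ) :
    ∑ k ∈ Finset.Icc 1 Y, 1 / (k : ℝ) ≤ 1 + Real.log Y := by
  have h := harmonic_le_one_add_log Y
  rw [harmonic_eq_sum_Icc] at h
  push_cast at h
  simpa using h

lemma sum_erase_one_div_abs_sub_le {m Y : ℕ} (hm : m ∈ Finset.Icc 1 Y) :
    ∑ n ∈ (Finset.Icc 1 Y).erase m, 1 / |(m : ℝ) - n| ≤ 2 * (1 + Real.log Y) := by
  have hm' := Finset.mem_Icc.1 hm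
  have hset : (Finset.Icc 1 Y).erase m = Finset.Ico 1 m ∪ Finset.Ioc m Y := by
    ext n
    simp only [Finset.mem_erase, Finset.mem_Icc, Finset.mem_union, Finset.mem_Ico, Finset.mem_Ioc]
    omega
  have hdisj : Disjoint (Finset.Ico 1 m) (Finset.Ioc m Y) := by
    rw [Finset.disjoint_left]
    intro n h1 h2
    exact absurd (Finset.mem_Ico.1 h1).2 (not_lt.2 (Finset.mem_Ioc.1 h2).1.le)
  have hmono : ∀ Z ≤ Y, ∑ k ∈ Finset.Icc 1 Z, 1 / (k : ℝ) ≤ 1 + Real.log Y := fun Z hZ => by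
    refine le_trans ?_ (sum_Icc_one_div_le Y)
    exact Finset.sum_le_sum_of_subset_of_nonneg (Finset.Icc_subset_Icc_right hZ)
      fun _ _ _ => by positivity
  have h1 : ∑ n ∈ Finset.Ico 1 m, 1 / |(m : ℝ) - n| = ∑ k ∈ Finset.Icc 1 (m - 1), 1 / (k : ℝ) := by
    refine Finset.sum_nbij' (fun n => m - n) (fun k => m - k) ?_ ?_ ?_ ?_ ?_
    all_goals intro n hn
    all_goals simp only [Finset.mem_Ico, Finset.mem_Icc] at hn ⊢
    · omega
    · omega
    · omega
    · omega
    · have : (n : ℝ) < m := by exact_mod_cast hn.2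
      rw [Nat.cast_sub hn.2.le, abs_of_pos (by linarith)]
  have h2 : ∑ n ∈ Finset.Ioc m Y, 1 / |(m : ℝ) - n| = ∑ k ∈ Finset.Icc 1 (Y - m), 1 / (k : ℝ) := by
    refine Finset.sum_nbij' (fun n => n - m) (fun k => m + k) ?_ ?_ ?_ ?_ ?_
    all_goals intro n hn
    all_goals simp only [Finset.mem_Ioc, Finset.mem_Icc] at hn ⊢
    · omega
    · omega
    · omega
    · omega
    · have : (m : ℝ) < n := by exact_mod_cast hn.1
      rw [Nat.cast_sub hn.1.le, abs_sub_comm, abs_of_pos (by linarith)]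
  rw [hset, Finset.sum_union hdisj, h1, h2, two_mul]
  exact add_le_add (hmono _ (by omega)) (hmono _ (by omega))

lemma exists_sum_Ioc_rpow_neg_le {θ : ℝ} (hθ : 1 / 2 < θ) :
    ∃ Z : ℝ, 0 < Z ∧ ∀ X Y : ℕ, 1 ≤ X →
      ∑ n ∈ Finset.Ioc X Y, ((n : ℝ) ^ (-θ)) ^ 2 ≤ Z * (X : ℝ) ^ (1 / 2 - θ) := by
  have hs : Summable fun n : ℕ => (n : ℝ) ^ (-(θ + 1 / 2)) :=
    Real.summable_nat_rpow.2 (by linarith)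
  have hnn : ∀ n : ℕ, 0 ≤ (n : ℝ) ^ (-(θ + 1 / 2)) := fun n => by positivity
  refine ⟨∑' n : ℕ, (n : ℝ) ^ (-(θ + 1 / 2)), ?_, fun X Y hX => ?_⟩
  · exact hs.tsum_pos hnn 1 (by simp)
  · calc ∑ n ∈ Finset.Ioc X Y, ((n : ℝ) ^ (-θ)) ^ 2
        ≤ ∑ n ∈ Finset.Ioc X Y, (n : ℝ) ^ (-(θ + 1 / 2)) * (X : ℝ) ^ (1 / 2 - θ) := by
          refine Finset.sum_le_sum fun n hn => ?_
          have hXn := (Finset.mem_Ioc.1 hn).1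
          have hX0 : (0 : ℝ) < X := by exact_mod_cast hX
          have hXn' : (X : ℝ) ≤ n := by exact_mod_cast hXn.le
          have hn0 : (0 : ℝ) < n := by linarith
          rw [← Real.rpow_mul_natCast hn0.le,
            show -θ * (2 : ℕ) = -(θ + 1 / 2) + (1 / 2 - θ) by push_cast; ring, Real.rpow_add hn0]
          exact mul_le_mul_of_nonneg_left
            (Real.rpow_le_rpow_of_nonpos hX0 hXn' (by linarith)) (by positivity)
      _ ≤ _ := by
          rw [← Finset.sum_mul]
          gcongr
          exact hs.sum_le_tsum _ fun n _ => hnn n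

/-- A mean value theorem for Dirichlet polynomials. -/
lemma exists_integral_norm_sq_dirichlet_le {θ : ℝ} (hθ : 1 / 2 < θ) (hθ' : θ < 1) :
    ∃ C : ℝ, 0 < C ∧ ∀ (A : ℝ) (c : ℕ → ℂ) (X Y : ℕ), 1 ≤ X → X ≤ Y →
      (∀ n ∈ Finset.Ioc X Y, ‖c n‖ ≤ A * (n : ℝ) ^ (-θ)) → ∀ a b : ℝ, a ≤ b →
      ∫ t in a..b, ‖∑ n ∈ Finset.Ioc X Y, c n * exp (I * (-Real.log n : ℝ) * t)‖ ^ 2 ≤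
        C * A ^ 2 * ((b - a) * (X : ℝ) ^ (1 / 2 - θ)
          + (Y : ℝ) ^ (2 - 2 * θ) * (1 + Real.log Y)) := by
  obtain ⟨Z, hZ, hdiag⟩ := exists_sum_Ioc_rpow_neg_le hθ
  have h1θ : 0 < 1 - θ := by linarith
  refine ⟨Z + (2 / (1 - θ) ^ 2 + 2 / (1 - θ)), by positivity, ?_⟩
  intro A c X Y hX hXY hc a b hab
  set S := Finset.Ioc X Y with hS
  have hpos : ∀ n ∈ S, (0 : ℝ) < n := fun n hn => by
    have := (Finset.mem_Ioc.1 hn).1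
    exact_mod_cast (by omega : 0 < n)
  have hsub : S ⊆ Finset.Icc 1 Y := fun n hn => by
    have := Finset.mem_Ioc.1 hn
    exact Finset.mem_Icc.2 ⟨by omega, this.2⟩
  have hY1 : (1 : ℝ) ≤ Y := by exact_mod_cast hX.trans hXY
  have hY0 : (0 : ℝ) < Y := by linarith
  have hlogY := Real.log_nonneg hY1
  have hinj : Set.InjOn (fun n : ℕ => (-Real.log n : ℝ)) S := fun m hm n hn h => by
    have := Real.log_injOn_pos (hpos m hm) (hpos n hn) (neg_injective h)
    exact_mod_cast this
  refine (integral_norm_sq_sum_exp_le S c _ hinj hab).trans ?_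
  have hD : (b - a) * ∑ n ∈ S, ‖c n‖ ^ 2 ≤ (b - a) * (A ^ 2 * (Z * (X : ℝ) ^ (1 / 2 - θ))) := by
    refine mul_le_mul_of_nonneg_left ?_ (by linarith)
    refine le_trans ?_ (mul_le_mul_of_nonneg_left (hdiag X Y hX) (sq_nonneg A))
    rw [Finset.mul_sum]
    refine Finset.sum_le_sum fun n hn => ?_
    rw [← mul_pow]
    exact pow_le_pow_left₀ (norm_nonneg _) (hc n hn) 2
  have hO : ∑ m ∈ S, ∑ n ∈ S.erase m, ‖c m‖ * ‖c n‖ * (2 / |(-Real.log m : ℝ) - -Real.log n|)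
      ≤ 2 * A ^ 2 * ((∑ m ∈ Finset.Icc 1 Y, (m : ℝ) ^ (-θ)) ^ 2
        + (∑ m ∈ Finset.Icc 1 Y, (m : ℝ) ^ (-(2 * θ - 1))) * (2 * (1 + Real.log Y))) := by
    have hterm : ∀ m ∈ S, ∀ n ∈ S.erase m,
        ‖c m‖ * ‖c n‖ * (2 / |(-Real.log m : ℝ) - -Real.log n|)
          ≤ 2 * A ^ 2 * ((m : ℝ) ^ (-θ) * (n : ℝ) ^ (-θ)
            + (m : ℝ) ^ (-(2 * θ - 1)) * (1 / |(m : ℝ) - n|)) := by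
      intro m hm n hn
      have hnS := Finset.mem_of_mem_erase hn
      have hne : (m : ℝ) ≠ n := by exact_mod_cast (Finset.ne_of_mem_erase hn).symm
      have h1 := rpow_mul_rpow_div_abs_log_le (θ := θ) (by linarith) hθ'.le (hpos m hm)
        (hpos n hnS) hne
      have e : |(-Real.log m : ℝ) - -Real.log n| = |Real.log m - Real.log n| := by
        rw [neg_sub_neg, abs_sub_comm]
      rw [e, show -(2 * θ - 1) = 1 - 2 * θ by ring]
      calc ‖c m‖ * ‖c n‖ * (2 / |Real.log m - Real.log n|)
          ≤ (A * (m : ℝ) ^ (-θ)) * (A * (n : ℝ) ^ (-θ)) * (2 / |Real.log m - Real.log n|) := by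
            refine mul_le_mul_of_nonneg_right ?_ (by positivity)
            exact mul_le_mul (hc m hm) (hc n hnS) (norm_nonneg _)
              ((norm_nonneg _).trans (hc m hm))
        _ = 2 * A ^ 2 * ((m : ℝ) ^ (-θ) * (n : ℝ) ^ (-θ)
              * (1 / |Real.log m - Real.log n|)) := by ring
        _ ≤ _ := by gcongr
    refine (Finset.sum_le_sum fun m hm => Finset.sum_le_sum (hterm m hm)).trans ?_
    simp_rw [← Finset.mul_sum]
    refine mul_le_mul_of_nonneg_left ?_ (by positivity)
    simp_rw [Finset.sum_add_distrib, ← Finset.mul_sum]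
    refine add_le_add ?_ ?_
    · rw [sq, Finset.sum_mul]
      refine (Finset.sum_le_sum fun m hm => ?_).trans
        (Finset.sum_le_sum_of_subset_of_nonneg hsub fun m _ _ => by positivity)
      refine mul_le_mul_of_nonneg_left ?_ (by positivity)
      exact Finset.sum_le_sum_of_subset_of_nonneg ((Finset.erase_subset _ _).trans hsub)
        fun n _ _ => by positivity
    · rw [Finset.sum_mul]
      refine (Finset.sum_le_sum fun m hm => ?_).trans
        (Finset.sum_le_sum_of_subset_of_nonneg hsub fun m _ _ => by positivity)
      refine mul_le_mul_of_nonneg_left ?_ (by positivity)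
      refine le_trans ?_ (sum_erase_one_div_abs_sub_le (hsub hm))
      exact Finset.sum_le_sum_of_subset_of_nonneg (Finset.erase_subset_erase m hsub)
        fun n _ _ => by positivity
  have hs1 := sum_Icc_rpow_neg_le (show 0 < θ by linarith) hθ' Y
  have hs2 := sum_Icc_rpow_neg_le (θ := 2 * θ - 1) (by linarith) (by linarith) Y
  have hs1sq : (∑ m ∈ Finset.Icc 1 Y, (m : ℝ) ^ (-θ)) ^ 2
      ≤ (Y : ℝ) ^ (2 - 2 * θ) * (1 + Real.log Y) / (1 - θ) ^ 2 := by
    calc (∑ m ∈ Finset.Icc 1 Y, (m : ℝ) ^ (-θ)) ^ 2 ≤ ((Y : ℝ) ^ (1 - θ) / (1 - θ)) ^ 2 :=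
          pow_le_pow_left₀ (Finset.sum_nonneg fun m _ => by positivity) hs1 2
      _ = (Y : ℝ) ^ (2 - 2 * θ) * 1 / (1 - θ) ^ 2 := by
          rw [div_pow, ← Real.rpow_mul_natCast hY0.le, mul_one]
          congr 2; push_cast; ring
      _ ≤ _ := by gcongr; linarith
  have e2 : 1 - (2 * θ - 1) = 2 * (1 - θ) := by ring
  rw [e2] at hs2
  set W := (Y : ℝ) ^ (2 - 2 * θ) * (1 + Real.log Y) with hW
  have hs2' : (∑ m ∈ Finset.Icc 1 Y, (m : ℝ) ^ (-(2 * θ - 1))) * (2 * (1 + Real.log Y))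
      ≤ W / (1 - θ) := by
    calc _ ≤ (Y : ℝ) ^ (2 * (1 - θ)) / (2 * (1 - θ)) * (2 * (1 + Real.log Y)) := by gcongr
      _ = W / (1 - θ) := by
          rw [hW, show 2 * (1 - θ) = 2 - 2 * θ by ring]
          have : (0 : ℝ) < 2 - 2 * θ := by linarith
          field_simp
  have hWnn : 0 ≤ W := by positivity
  have hDnn : 0 ≤ (b - a) * (X : ℝ) ^ (1 / 2 - θ) := mul_nonneg (by linarith) (by positivity)
  calc _ ≤ (b - a) * (A ^ 2 * (Z * (X : ℝ) ^ (1 / 2 - θ)))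
        + 2 * A ^ 2 * (W / (1 - θ) ^ 2 + W / (1 - θ)) := by
        refine add_le_add hD (hO.trans ?_)
        gcongr
    _ = A ^ 2 * (Z * ((b - a) * (X : ℝ) ^ (1 / 2 - θ))
        + (2 / (1 - θ) ^ 2 + 2 / (1 - θ)) * W) := by ring
    _ ≤ A ^ 2 * ((Z + (2 / (1 - θ) ^ 2 + 2 / (1 - θ))) * ((b - a) * (X : ℝ) ^ (1 / 2 - θ))
        + (Z + (2 / (1 - θ) ^ 2 + 2 / (1 - θ))) * W) := by
        exact mul_le_mul_of_nonneg_left (add_le_add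
          (mul_le_mul_of_nonneg_right (le_add_of_nonneg_right (by positivity)) hDnn)
          (mul_le_mul_of_nonneg_right (le_add_of_nonneg_left hZ.le) hWnn)) (sq_nonneg A)
    _ = _ := by ring

lemma norm_sq_le_norm_sq_add_integral {g g' : ℝ → ℂ} (hg : ∀ t, HasDerivAt g (g' t) t)
    (hg' : Continuous g') {c d x y : ℝ} (hx : x ∈ Set.Icc c d) (hy : y ∈ Set.Icc c d) :
    ‖g y‖ ^ 2 ≤ ‖g x‖ ^ 2 + ∫ t in c..d, (‖g t‖ ^ 2 + ‖g' t‖ ^ 2) := by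
  have hgc : Continuous g := continuous_iff_continuousAt.2 fun t => (hg t).continuousAt
  have hΦ : Continuous fun t => ‖g t‖ ^ 2 + ‖g' t‖ ^ 2 := by fun_prop
  have hD : Continuous fun t => 2 * inner ℝ (g t) (g' t) := by fun_prop
  have hftc : ∫ t in x..y, 2 * inner ℝ (g t) (g' t) = ‖g y‖ ^ 2 - ‖g x‖ ^ 2 :=
    intervalIntegral.integral_eq_sub_of_hasDerivAt (fun t _ => (hg t).norm_sq)
      (hD.intervalIntegrable _ _)
  have hbd : ∀ t, |2 * inner ℝ (g t) (g' t)| ≤ ‖g t‖ ^ 2 + ‖g' t‖ ^ 2 := fun t => by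
    rw [abs_mul, abs_two]
    nlinarith [abs_real_inner_le_norm (g t) (g' t), sq_nonneg (‖g t‖ - ‖g' t‖)]
  have hmono : ∀ u ∈ Set.Icc c d, ∀ v ∈ Set.Icc c d, u ≤ v →
      |∫ t in u..v, 2 * inner ℝ (g t) (g' t)| ≤ ∫ t in c..d, (‖g t‖ ^ 2 + ‖g' t‖ ^ 2) := by
    intro u hu v hv huv
    refine (intervalIntegral.abs_integral_le_integral_abs huv).trans ?_
    refine (intervalIntegral.integral_mono_on huv (hD.abs.intervalIntegrable _ _)
      (hΦ.intervalIntegrable _ _) fun t _ => hbd t).trans ?_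
    exact intervalIntegral.integral_mono_interval hu.1 huv hv.2
      (Eventually.of_forall fun t => by positivity) (hΦ.intervalIntegrable _ _)
  rcases le_total x y with h | h
  · have h1 := le_of_abs_le (hmono x hx y hy h)
    linarith
  · have h1 := neg_le_of_abs_le (hmono y hy x hx h)
    rw [intervalIntegral.integral_symm] at hftc
    linarith

lemma norm_sq_le_integral {g g' : ℝ → ℂ} (hg : ∀ t, HasDerivAt g (g' t) t)
    (hg' : Continuous g') {a b t₀ : ℝ} (ht₀ : t₀ ∈ Set.Icc a b) (hab : a + 1 ≤ b) :
    ‖g t₀‖ ^ 2 ≤ ∫ t in a..b, (2 * ‖g t‖ ^ 2 + ‖g' t‖ ^ 2) := by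
  have hgc : Continuous g := continuous_iff_continuousAt.2 fun t => (hg t).continuousAt
  have hΦ : Continuous fun t => ‖g t‖ ^ 2 + ‖g' t‖ ^ 2 := by fun_prop
  set R := ∫ t in a..b, (‖g t‖ ^ 2 + ‖g' t‖ ^ 2) with hR
  have hle : a ≤ b := by linarith
  have h1 : ∫ t in a..b, (‖g t₀‖ ^ 2 - R) ≤ ∫ t in a..b, ‖g t‖ ^ 2 := by
    refine intervalIntegral.integral_mono_on hle (by simp)
      (Continuous.intervalIntegrable (by fun_prop) _ _) fun t ht => ?_
    have := norm_sq_le_norm_sq_add_integral hg hg' ht ht₀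
    linarith
  have h2 : ∫ t in a..b, (2 * ‖g t‖ ^ 2 + ‖g' t‖ ^ 2) = (∫ t in a..b, ‖g t‖ ^ 2) + R := by
    rw [hR, ← intervalIntegral.integral_add (Continuous.intervalIntegrable (by fun_prop) _ _)
      (hΦ.intervalIntegrable _ _)]
    exact intervalIntegral.integral_congr fun t _ => by ring
  have h3 : 0 ≤ ∫ t in a..b, ‖g t‖ ^ 2 :=
    intervalIntegral.integral_nonneg hle fun t _ => by positivity
  rw [intervalIntegral.integral_const, smul_eq_mul] at h1
  rw [h2]
  by_contra! hlt
  nlinarith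

section Box

variable {f₀ f₁ f₂ : ℂ → ℂ}

lemma norm_sq_le_integral_vertical (h₀ : ∀ z, HasDerivAt f₀ (f₁ z) z) (h₁ : Continuous f₁)
    {a b t₀ : ℝ} (v : ℝ) (ht₀ : t₀ ∈ Set.Icc a b) (hab : a + 1 ≤ b) :
    ‖f₀ (v + t₀ * I)‖ ^ 2
      ≤ ∫ t in a..b, (2 * ‖f₀ (v + t * I)‖ ^ 2 + ‖f₁ (v + t * I)‖ ^ 2) := by
  have hd : ∀ t : ℝ, HasDerivAt (fun t : ℝ => f₀ (v + t * I)) (f₁ (v + t * I) * I) t := by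
    intro t
    have h : HasDerivAt (fun t : ℝ => (v : ℂ) + t * I) I t := by
      simpa using ((hasDerivAt_id t).ofReal_comp.mul_const I).const_add (v : ℂ)
    exact (h₀ _).comp t h
  have := norm_sq_le_integral hd (by fun_prop) ht₀ hab
  simpa only [norm_mul, norm_I, mul_one] using this

lemma norm_sq_le_integral_box (h₀ : ∀ z, HasDerivAt f₀ (f₁ z) z)
    (h₁ : ∀ z, HasDerivAt f₁ (f₂ z) z) (h₂ : Continuous f₂) {σ₀ σ' σ a b t₀ : ℝ}
    (hσ : σ ∈ Set.Icc σ₀ σ') (ht₀ : t₀ ∈ Set.Icc a b) (hab : a + 1 ≤ b) :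
    ‖f₀ (σ + t₀ * I)‖ ^ 2 ≤
      (∫ t in a..b, 3 * (‖f₀ (σ₀ + t * I)‖ ^ 2 + ‖f₁ (σ₀ + t * I)‖ ^ 2
        + ‖f₂ (σ₀ + t * I)‖ ^ 2))
      + ∫ v in σ₀..σ', ∫ t in a..b, 3 * (‖f₀ (v + t * I)‖ ^ 2 + ‖f₁ (v + t * I)‖ ^ 2
        + ‖f₂ (v + t * I)‖ ^ 2) := by
  have c₀ : Continuous f₀ := continuous_iff_continuousAt.2 fun t => (h₀ t).continuousAt
  have c₁ : Continuous f₁ := continuous_iff_continuousAt.2 fun t => (h₁ t).continuousAt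
  have hle : a ≤ b := by linarith
  have hσ' : σ₀ ≤ σ' := hσ.1.trans hσ.2
  have hd : ∀ v : ℝ, HasDerivAt (fun v : ℝ => f₀ (v + t₀ * I)) (f₁ (v + t₀ * I)) v := by
    intro v
    have h : HasDerivAt (fun v : ℝ => (v : ℂ) + t₀ * I) 1 v := by
      simpa using (hasDerivAt_id v).ofReal_comp.add_const ((t₀ : ℂ) * I)
    have h' := (h₀ _).comp v h
    rwa [mul_one] at h'
  have hH := norm_sq_le_norm_sq_add_integral hd (by fun_prop)
    (Set.left_mem_Icc.2 hσ') hσ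
  refine hH.trans (add_le_add ?_ ?_)
  · refine (norm_sq_le_integral_vertical h₀ c₁ σ₀ ht₀ hab).trans ?_
    refine intervalIntegral.integral_mono_on hle (Continuous.intervalIntegrable (by fun_prop) _ _)
      (Continuous.intervalIntegrable (by fun_prop) _ _) fun t _ => ?_
    nlinarith [sq_nonneg ‖f₀ (σ₀ + t * I)‖, sq_nonneg ‖f₁ (σ₀ + t * I)‖,
      sq_nonneg ‖f₂ (σ₀ + t * I)‖]
  · refine intervalIntegral.integral_mono_on hσ' (Continuous.intervalIntegrable (by fun_prop) _ _)
      (Continuous.intervalIntegrable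
        (intervalIntegral.continuous_parametric_intervalIntegral_of_continuous' (by fun_prop) _ _)
        _ _) fun v _ => ?_
    refine (add_le_add (norm_sq_le_integral_vertical h₀ c₁ v ht₀ hab)
      (norm_sq_le_integral_vertical h₁ h₂ v ht₀ hab)).trans ?_
    rw [← intervalIntegral.integral_add (Continuous.intervalIntegrable (by fun_prop) _ _)
      (Continuous.intervalIntegrable (by fun_prop) _ _)]
    refine intervalIntegral.integral_mono_on hle (Continuous.intervalIntegrable (by fun_prop) _ _)
      (Continuous.intervalIntegrable (by fun_prop) _ _) fun t _ => ?_
    nlinarith [sq_nonneg ‖f₀ (v + t * I)‖, sq_nonneg ‖f₁ (v + t * I)‖,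
      sq_nonneg ‖f₂ (v + t * I)‖]

lemma sum_norm_sq_le_of_integral_le (h₀ : ∀ z, HasDerivAt f₀ (f₁ z) z)
    (h₁ : ∀ z, HasDerivAt f₁ (f₂ z) z) (h₂ : Continuous f₂) {σ₀ σ' a L M : ℝ} {K : ℕ}
    (hL : 1 ≤ L) (hσ' : σ₀ ≤ σ') {σ t : ℕ → ℝ} (hσ : ∀ j < K, σ j ∈ Set.Icc σ₀ σ')
    (ht : ∀ j < K, t j ∈ Set.Icc (a + j * L) (a + (j + 1 : ℕ) * L))
    (hM : ∀ v ∈ Set.Icc σ₀ σ', ∫ t in a..(a + K * L), 3 * (‖f₀ (v + t * I)‖ ^ 2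
      + ‖f₁ (v + t * I)‖ ^ 2 + ‖f₂ (v + t * I)‖ ^ 2) ≤ M) :
    ∑ j ∈ Finset.range K, ‖f₀ (σ j + t j * I)‖ ^ 2 ≤ M * (1 + (σ' - σ₀)) := by
  have c₀ : Continuous f₀ := continuous_iff_continuousAt.2 fun t => (h₀ t).continuousAt
  have c₁ : Continuous f₁ := continuous_iff_continuousAt.2 fun t => (h₁ t).continuousAt
  set H : ℝ → ℝ → ℝ := fun v t => 3 * (‖f₀ (v + t * I)‖ ^ 2 + ‖f₁ (v + t * I)‖ ^ 2
      + ‖f₂ (v + t * I)‖ ^ 2) with hH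
  have hHc : Continuous (Function.uncurry H) := by
    simp only [hH, Function.uncurry_def]; fun_prop
  have hHt : ∀ v, Continuous (H v) := fun v => by fun_prop
  have hint : ∀ c d, IntervalIntegrable (fun v => ∫ t in c..d, H v t) MeasureTheory.volume σ₀ σ' :=
    fun c d => Continuous.intervalIntegrable
      (intervalIntegral.continuous_parametric_intervalIntegral_of_continuous' hHc _ _) _ _
  have hadj : ∀ v, ∑ j ∈ Finset.range K, ∫ t in (a + j * L)..(a + (j + 1 : ℕ) * L), H v t
      = ∫ t in a..(a + K * L), H v t := fun v => by
    have := intervalIntegral.sum_integral_adjacent_intervals (f := H v)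
      (μ := MeasureTheory.volume) (a := fun j : ℕ => a + j * L) (n := K)
      fun j _ => (hHt v).intervalIntegrable _ _
    simpa using this
  calc ∑ j ∈ Finset.range K, ‖f₀ (σ j + t j * I)‖ ^ 2
      ≤ ∑ j ∈ Finset.range K, ((∫ t in (a + j * L)..(a + (j + 1 : ℕ) * L), H σ₀ t)
        + ∫ v in σ₀..σ', ∫ t in (a + j * L)..(a + (j + 1 : ℕ) * L), H v t) := by
        refine Finset.sum_le_sum fun j hj => ?_
        have hj := Finset.mem_range.1 hj
        exact norm_sq_le_integral_box h₀ h₁ h₂ (hσ j hj) (ht j hj) (by push_cast; linarith)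
    _ = (∫ t in a..(a + K * L), H σ₀ t) + ∫ v in σ₀..σ', ∫ t in a..(a + K * L), H v t := by
        rw [Finset.sum_add_distrib, hadj,
          ← intervalIntegral.integral_finsetSum fun j _ => hint _ _]
        simp_rw [hadj]
    _ ≤ M + ∫ v in σ₀..σ', M := by
        refine add_le_add (hM σ₀ (Set.left_mem_Icc.2 hσ')) ?_
        exact intervalIntegral.integral_mono_on hσ' (hint _ _) (by simp) hM
    _ = M * (1 + (σ' - σ₀)) := by
        rw [intervalIntegral.integral_const, smul_eq_mul]; ring

end Box

/-- The `k`-th derivative of the Dirichlet polynomial `∑ b n / n ^ z` over `n ∈ S`. -/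
noncomputable def dirichletPoly (S : Finset ℕ) (b : ℕ → ℂ) (k : ℕ) (z : ℂ) : ℂ :=
  ∑ n ∈ S, b n * (-(Real.log n : ℂ)) ^ k * exp (-(z * Real.log n))

lemma hasDerivAt_dirichletPoly (S : Finset ℕ) (b : ℕ → ℂ) (k : ℕ) (z : ℂ) :
    HasDerivAt (dirichletPoly S b k) (dirichletPoly S b (k + 1) z) z := by
  refine HasDerivAt.fun_sum fun n _ => ?_
  have h : HasDerivAt (fun z : ℂ => -(z * (Real.log n : ℂ))) (-(1 * (Real.log n : ℂ))) z :=
    ((hasDerivAt_id z).mul_const _).neg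
  have h' := h.cexp.const_mul (b n * (-(Real.log n : ℂ)) ^ k)
  refine h'.congr_deriv ?_
  ring

lemma continuous_dirichletPoly (S : Finset ℕ) (b : ℕ → ℂ) (k : ℕ) :
    Continuous (dirichletPoly S b k) := by
  unfold dirichletPoly
  fun_prop

lemma dirichletPoly_zero_eq (X Y : ℕ) (b : ℕ → ℂ) (z : ℂ) :
    dirichletPoly (Finset.Ioc X Y) b 0 z = ∑ n ∈ Finset.Ioc X Y, b n * (n : ℂ) ^ (-z) := by
  refine Finset.sum_congr rfl fun n hn => ?_
  have hn : n ≠ 0 := by have := (Finset.mem_Ioc.1 hn).1; omega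
  rw [pow_zero, mul_one, cpow_def_of_ne_zero (by exact_mod_cast hn), natCast_log]
  congr 2
  ring

lemma exists_integral_norm_sq_dirichletPoly_le {σ₀ η : ℝ} (hη : 0 < η) (hση : 1 / 2 < σ₀ - η)
    (hσ₀ : σ₀ < 1) :
    ∃ C : ℝ, 0 < C ∧ ∀ (b : ℕ → ℂ), (∀ n, ‖b n‖ ≤ n.divisors.card) → ∀ X Y : ℕ, 1 ≤ X → X ≤ Y →
      ∀ k ≤ 2, ∀ v, σ₀ ≤ v → ∀ t₁ t₂, t₁ ≤ t₂ →
      ∫ t in t₁..t₂, ‖dirichletPoly (Finset.Ioc X Y) b k (v + t * I)‖ ^ 2 ≤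
        C * ((t₂ - t₁) * (X : ℝ) ^ (1 / 2 - (σ₀ - η))
          + (Y : ℝ) ^ (2 - 2 * (σ₀ - η)) * (1 + Real.log Y)) := by
  obtain ⟨C, hC, hmean⟩ := exists_integral_norm_sq_dirichlet_le hση (by linarith)
  obtain ⟨A, hA, hdiv⟩ := exists_card_divisors_mul_log_pow_le hη (by linarith)
  refine ⟨C * A ^ 2, by positivity, fun b hb X Y hX hXY k hk v hv t₁ t₂ ht => ?_⟩
  set c : ℕ → ℂ := fun n => b n * (-(Real.log n : ℂ)) ^ k * exp (-(v * Real.log n)) with hc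
  have hbd : ∀ n ∈ Finset.Ioc X Y, ‖c n‖ ≤ A * (n : ℝ) ^ (-(σ₀ - η)) := by
    intro n hn
    have hn1 : 1 ≤ n := by have := (Finset.mem_Ioc.1 hn).1; omega
    have hn1' : (1 : ℝ) ≤ n := by exact_mod_cast hn1
    have hn0 : (0 : ℝ) < n := by linarith
    have hexp : ‖exp (-((v : ℂ) * Real.log n))‖ = (n : ℝ) ^ (-v) := by
      rw [← ofReal_mul, ← ofReal_neg, norm_exp_ofReal, Real.rpow_def_of_pos hn0]
      congr 1; ring
    have hlog : ‖(-(Real.log n : ℂ)) ^ k‖ = Real.log n ^ k := by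
      rw [norm_pow, norm_neg, norm_real, Real.norm_of_nonneg (Real.log_nonneg hn1')]
    rw [hc]
    simp only [norm_mul]
    rw [hexp, hlog]
    have hlog0 := Real.log_nonneg hn1'
    calc ‖b n‖ * Real.log n ^ k * (n : ℝ) ^ (-v)
        ≤ n.divisors.card * Real.log n ^ k * (n : ℝ) ^ (-v) :=
          mul_le_mul_of_nonneg_right (mul_le_mul_of_nonneg_right (hb n) (by positivity))
            (by positivity)
      _ ≤ A * (n : ℝ) ^ η * (n : ℝ) ^ (-σ₀) :=
          mul_le_mul (hdiv n hn1 k hk)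
            (Real.rpow_le_rpow_of_exponent_le hn1' (by linarith)) (by positivity) (by positivity)
      _ = A * (n : ℝ) ^ (-(σ₀ - η)) := by
          rw [mul_assoc, ← Real.rpow_add hn0]; congr 2; ring
  have heq : ∀ t : ℝ, dirichletPoly (Finset.Ioc X Y) b k (v + t * I)
      = ∑ n ∈ Finset.Ioc X Y, c n * exp (I * (-Real.log n : ℝ) * t) := by
    intro t
    refine Finset.sum_congr rfl fun n _ => ?_
    rw [hc]
    simp only
    rw [mul_assoc _ (exp _) (exp _), ← exp_add]
    congr 2
    push_cast; ring
  simp_rw [heq]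
  exact hmean A c X Y hX hXY hbd t₁ t₂ ht

lemma exists_sum_norm_sq_dirichletPoly_le {σ₀ η : ℝ} (hη : 0 < η) (hση : 1 / 2 < σ₀ - η)
    (hσ₀ : σ₀ < 1) :
    ∃ C : ℝ, 0 < C ∧ ∀ (b : ℕ → ℂ), (∀ n, ‖b n‖ ≤ n.divisors.card) → ∀ X Y : ℕ, 1 ≤ X → X ≤ Y →
      ∀ (a L : ℝ) (K : ℕ), 1 ≤ L → ∀ σ t : ℕ → ℝ, (∀ j < K, σ j ∈ Set.Icc σ₀ 1) →
      (∀ j < K, t j ∈ Set.Icc (a + j * L) (a + (j + 1 : ℕ) * L)) →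
      ∑ j ∈ Finset.range K, ‖dirichletPoly (Finset.Ioc X Y) b 0 (σ j + t j * I)‖ ^ 2 ≤
        C * (K * L * (X : ℝ) ^ (1 / 2 - (σ₀ - η))
          + (Y : ℝ) ^ (2 - 2 * (σ₀ - η)) * (1 + Real.log Y)) := by
  obtain ⟨C, hC, hint⟩ := exists_integral_norm_sq_dirichletPoly_le hη hση hσ₀
  refine ⟨9 * C * (1 + (1 - σ₀)), by nlinarith, ?_⟩
  intro b hb X Y hX hXY a L K hL σ t hσ ht
  set R := (K * L * (X : ℝ) ^ (1 / 2 - (σ₀ - η))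
          + (Y : ℝ) ^ (2 - 2 * (σ₀ - η)) * (1 + Real.log Y)) with hR
  have hc := continuous_dirichletPoly (Finset.Ioc X Y) b
  have hM : ∀ v ∈ Set.Icc σ₀ 1, ∫ t in a..(a + K * L),
      3 * (‖dirichletPoly (Finset.Ioc X Y) b 0 (v + t * I)‖ ^ 2
        + ‖dirichletPoly (Finset.Ioc X Y) b 1 (v + t * I)‖ ^ 2
        + ‖dirichletPoly (Finset.Ioc X Y) b 2 (v + t * I)‖ ^ 2) ≤ 9 * C * R := by
    intro v hv
    have hi : ∀ k, IntervalIntegrable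
        (fun t : ℝ => ‖dirichletPoly (Finset.Ioc X Y) b k (v + t * I)‖ ^ 2)
        MeasureTheory.volume a (a + K * L) := fun k => by
      have := hc k
      exact Continuous.intervalIntegrable (by fun_prop) _ _
    have hk : ∀ k ≤ 2, ∫ t in a..(a + K * L),
        ‖dirichletPoly (Finset.Ioc X Y) b k (v + t * I)‖ ^ 2 ≤ C * R := fun k hk => by
      have hKL : 0 ≤ K * L := by positivity
      have := hint b hb X Y hX hXY k hk v hv.1 a (a + K * L) (by linarith)
      rwa [add_sub_cancel_left] at this
    rw [intervalIntegral.integral_const_mul,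
      intervalIntegral.integral_add ((hi 0).add (hi 1)) (hi 2),
      intervalIntegral.integral_add (hi 0) (hi 1)]
    have h0 := hk 0 (by norm_num)
    have h1 := hk 1 (by norm_num)
    have h2 := hk 2 le_rfl
    linarith
  refine (sum_norm_sq_le_of_integral_le (hasDerivAt_dirichletPoly _ b 0)
    (hasDerivAt_dirichletPoly _ b 1) (hc 2) hL hσ₀.le hσ ht hM).trans (le_of_eq ?_)
  ring

lemma norm_sum_moebius_le {s : ℂ} (hs : 0 ≤ s.re) (X : ℕ) :
    ‖∑ d ∈ Finset.Icc 1 X, (ArithmeticFunction.moebius d : ℂ) * (d : ℂ) ^ (-s)‖ ≤ X := by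
  refine (norm_sum_le_of_le (f := fun d : ℕ =>
    (ArithmeticFunction.moebius d : ℂ) * (d : ℂ) ^ (-s)) (n := fun _ => (1 : ℝ)) _
      fun d hd => ?_).trans (by simp)
  have hd1 := (Finset.mem_Icc.1 hd).1
  have hμ : ‖(ArithmeticFunction.moebius d : ℂ)‖ ≤ 1 := by
    rw [norm_intCast]
    exact_mod_cast ArithmeticFunction.abs_moebius_le_one
  have hp : ‖(d : ℂ) ^ (-s)‖ ≤ 1 := by
    rw [norm_natCast_cpow_of_pos hd1, neg_re]
    exact Real.rpow_le_one_of_one_le_of_nonpos (by exact_mod_cast hd1) (by linarith)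
  rw [norm_mul]
  exact mul_le_one₀ hμ (norm_nonneg _) hp

/-- At a zero of `ζ`, the mollified Dirichlet polynomial minus its constant term is not small. -/
lemma half_le_norm_dirichletPoly {s : ℂ} (hs : 0 ≤ s.re) {N X : ℕ} (hX : 1 ≤ X) (hXN : X < N)
    {E : ℝ} (hS : ‖∑ n ∈ Finset.Ico 1 N, (n : ℂ) ^ (-s)‖ ≤ E) (hE : E * X ≤ 1 / 2) :
    1 / 2 ≤ ‖dirichletPoly (Finset.Ioc X (N * X)) (fun n => mollifiedCoeff N X n) 0 s‖ := by
  rw [dirichletPoly_zero_eq]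
  have h := sum_mul_sum_moebius_eq hX hXN s
  set F := ∑ n ∈ Finset.Ioc X (N * X), (mollifiedCoeff N X n : ℂ) * (n : ℂ) ^ (-s)
  have h1 : ‖1 + F‖ ≤ 1 / 2 := by
    rw [← h, norm_mul]
    exact (mul_le_mul hS (norm_sum_moebius_le hs X) (norm_nonneg _)
      ((norm_nonneg _).trans hS)).trans hE
  have h2 := norm_sub_norm_le (1 : ℂ) (-F)
  rw [norm_one, norm_neg, sub_neg_eq_add] at h2
  linarith

lemma rpow_mul_one_add_log_le {κ : ℝ} (hκ : 0 < κ) (hκ' : κ ≤ 1 / 2) {T Y : ℝ} (hT : 1 ≤ T)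
    (hY : 1 ≤ Y) (hYT : Y ≤ 7 * T ^ (1 + κ / 4)) :
    Y ^ (1 - κ) * (1 + Real.log Y) ≤ 7 * (1 + 8 / κ) * T ^ (1 - κ / 2) := by
  have hY0 : 0 < Y := by linarith
  have hT0 : 0 < T := by linarith
  have hlog : 1 + Real.log Y ≤ (1 + 8 / κ) * Y ^ (κ / 8) := by
    have h1 := Real.log_le_rpow_div hY0.le (show 0 < κ / 8 by positivity)
    have h2 := Real.one_le_rpow hY (show 0 ≤ κ / 8 by positivity)
    have h3 : Y ^ (κ / 8) / (κ / 8) = 8 / κ * Y ^ (κ / 8) := by field_simp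
    linarith
  calc Y ^ (1 - κ) * (1 + Real.log Y) ≤ Y ^ (1 - κ) * ((1 + 8 / κ) * Y ^ (κ / 8)) :=
        mul_le_mul_of_nonneg_left hlog (by positivity)
    _ = (1 + 8 / κ) * Y ^ (1 - 7 * κ / 8) := by
        rw [show 1 - 7 * κ / 8 = (1 - κ) + κ / 8 by ring, Real.rpow_add hY0]; ring
    _ ≤ (1 + 8 / κ) * (7 * T ^ (1 - κ / 2)) := by
        refine mul_le_mul_of_nonneg_left ?_ (by positivity)
        refine (Real.rpow_le_rpow hY0.le hYT (by linarith)).trans ?_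
        rw [Real.mul_rpow (by norm_num) (by positivity), ← Real.rpow_mul hT0.le]
        refine mul_le_mul ?_ (Real.rpow_le_rpow_of_exponent_le hT (by nlinarith))
          (by positivity) (by norm_num)
        exact Real.rpow_le_self_of_one_le (by norm_num) (by linarith)
    _ = _ := by ring

/-- A bound for the number of zeros of `ζ` to the right of the critical line with well-spaced
ordinates in `[T, 2T]`. -/
lemma exists_card_spaced_zeros_le {σ₀ : ℝ} (hσ₀ : 1 / 2 < σ₀) (hσ₀' : σ₀ < 1) :
    ∃ δ C : ℝ, 0 < δ ∧ 0 < C ∧ ∀ᶠ T : ℝ in atTop, ∀ (L : ℝ) (K : ℕ), 1 ≤ L → K * L ≤ T →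
      ∀ s : ℕ → ℂ, (∀ j < K, σ₀ ≤ (s j).re ∧ riemannZeta (s j) = 0 ∧
        (s j).im ∈ Set.Icc (T + j * L) (T + (j + 1 : ℕ) * L)) → (K : ℝ) ≤ C * T ^ (1 - δ) := by
  set κ := σ₀ - 1 / 2 with hκdef
  have hκ : 0 < κ := by linarith
  have hκ' : κ < 1 / 2 := by linarith
  obtain ⟨C₁, hC₁, hzero⟩ := exists_norm_sum_Ico_natCast_cpow_neg_le_of_zero
    (σ₀ := σ₀) (η := κ / 2) (by linarith) (by linarith) hσ₀'
  obtain ⟨C₂, hC₂, hmean⟩ := exists_sum_norm_sq_dirichletPoly_le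
    (σ₀ := σ₀) (η := κ / 2) (by linarith) (by linarith) hσ₀'
  rw [show 1 / 2 - (σ₀ - κ / 2) = -(κ / 2) by rw [hκdef]; ring,
    show 2 - 2 * (σ₀ - κ / 2) = 1 - κ by rw [hκdef]; ring] at hmean
  rw [show 1 - 2 * σ₀ + 2 * (κ / 2) = -κ by rw [hκdef]; ring] at hzero
  refine ⟨κ ^ 2 / 8, 4 * (C₂ * (2 + 7 * (1 + 8 / κ))), by positivity, by positivity, ?_⟩
  have hlim : Tendsto (fun T : ℝ => C₁ * T ^ (-(3 * κ / 4))) atTop (nhds 0) := by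
    simpa using (tendsto_rpow_neg_atTop (show 0 < 3 * κ / 4 by positivity)).const_mul C₁
  filter_upwards [eventually_ge_atTop 1,
    hlim.eventually_le_const (show (0 : ℝ) < 1 / 2 by norm_num),
    (tendsto_rpow_atTop (show 0 < κ / 4 by positivity)).eventually_ge_atTop 2]
    with T hT1 hTC hT2 L K hL hKL s hs
  have hT0 : 0 < T := by linarith
  set X := ⌊T ^ (κ / 4)⌋₊ with hX
  set N := ⌈6 * T⌉₊ with hN
  have hXle : (X : ℝ) ≤ T ^ (κ / 4) := Nat.floor_le (by positivity)
  have hXge : T ^ (κ / 4) / 2 ≤ X := by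
    have := Nat.lt_floor_add_one (T ^ (κ / 4))
    linarith
  have hX1' : (1 : ℝ) ≤ X := by linarith
  have hX1 : 1 ≤ X := by exact_mod_cast hX1'
  have hX0 : (0 : ℝ) < X := by linarith
  have hNge : 6 * T ≤ N := Nat.le_ceil _
  have hNle : (N : ℝ) ≤ 7 * T := by
    have := Nat.ceil_lt_add_one (show 0 ≤ 6 * T by positivity)
    linarith
  have hN0 : (0 : ℝ) < N := by linarith
  have hTκ : T ^ (κ / 4) ≤ T := Real.rpow_le_self_of_one_le hT1 (by linarith)
  have hXN : X < N := by
    have : (X : ℝ) < N := by linarith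
    exact_mod_cast this
  have hN1 : 1 ≤ N := by omega
  have hY1 : (1 : ℝ) ≤ (N * X : ℕ) := by exact_mod_cast Nat.mul_pos hN1 hX1
  have hYle : ((N * X : ℕ) : ℝ) ≤ 7 * T ^ (1 + κ / 4) := by
    rw [Real.rpow_add hT0, Real.rpow_one, ← mul_assoc]
    push_cast
    exact mul_le_mul hNle hXle hX0.le (by positivity)
  have hsmall : C₁ * (N : ℝ) ^ (-κ) * X ≤ 1 / 2 := by
    refine le_trans ?_ hTC
    have h1 : (N : ℝ) ^ (-κ) ≤ T ^ (-κ) :=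
      Real.rpow_le_rpow_of_nonpos hT0 (by linarith) (by linarith)
    rw [mul_assoc, show -(3 * κ / 4) = -κ + κ / 4 by ring, Real.rpow_add hT0]
    exact mul_le_mul_of_nonneg_left (mul_le_mul h1 hXle hX0.le (by positivity)) hC₁
  have him : ∀ j < K, T ≤ (s j).im ∧ (s j).im ≤ 2 * T := by
    intro j hj
    obtain ⟨h1, h2⟩ := (hs j hj).2.2
    have h3 : ((j + 1 : ℕ) : ℝ) * L ≤ K * L :=
      mul_le_mul_of_nonneg_right (by exact_mod_cast hj) (by linarith)
    have h4 : 0 ≤ (j : ℝ) * L := by positivity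
    exact ⟨by linarith, by linarith⟩
  have hre : ∀ j < K, (s j).re ∈ Set.Icc σ₀ 1 := fun j hj => by
    refine ⟨(hs j hj).1, ?_⟩
    by_contra! h
    exact riemannZeta_ne_zero_of_one_le_re h.le (hs j hj).2.1
  have hlarge : ∀ j < K, 1 / 2 ≤ ‖dirichletPoly (Finset.Ioc X (N * X))
      (fun n => mollifiedCoeff N X n) 0 (s j)‖ := by
    intro j hj
    obtain ⟨h1, h2⟩ := him j hj
    obtain ⟨h3, h4⟩ := hre j hj
    have h5 := abs_im_le_norm (s j)
    have h6 := abs_im_le_norm (s j - 1)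
    have h7 := norm_le_abs_re_add_abs_im (s j)
    rw [sub_im, one_im, sub_zero] at h6
    rw [abs_of_pos (show 0 < (s j).im by linarith)] at h5 h6 h7
    rw [abs_of_pos (show 0 < (s j).re by linarith)] at h7
    exact half_le_norm_dirichletPoly (by linarith) hX1 hXN
      (hzero (s j) h3 (hs j hj).2.1 N hN1 (by linarith) (by linarith) (by linarith)) hsmall
  have hsum := hmean (fun n => mollifiedCoeff N X n)
    (fun n => by rw [norm_intCast]; exact_mod_cast abs_mollifiedCoeff_le N X n)
    X (N * X) hX1 (Nat.le_mul_of_pos_left X hN1) T L K hL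
    (fun j => (s j).re) (fun j => (s j).im) hre fun j hj => (hs j hj).2.2
  simp only [re_add_im] at hsum
  have hcard : (K : ℝ) * (1 / 4) ≤ ∑ j ∈ Finset.range K, ‖dirichletPoly (Finset.Ioc X (N * X))
      (fun n => mollifiedCoeff N X n) 0 (s j)‖ ^ 2 := by
    have h := Finset.card_nsmul_le_sum (Finset.range K) (fun j => ‖dirichletPoly
      (Finset.Ioc X (N * X)) (fun n => mollifiedCoeff N X n) 0 (s j)‖ ^ 2) (1 / 4) fun j hj => by
        have := hlarge j (Finset.mem_range.1 hj)
        nlinarith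
    simpa using h
  have hdiag : K * L * (X : ℝ) ^ (-(κ / 2)) ≤ 2 * T ^ (1 - κ ^ 2 / 8) := by
    have h1 : (X : ℝ) ^ (-(κ / 2)) ≤ 2 * T ^ (-(κ ^ 2 / 8)) := by
      refine (Real.rpow_le_rpow_of_nonpos (by positivity) hXge (by linarith)).trans ?_
      rw [Real.div_rpow (by positivity) (by norm_num), ← Real.rpow_mul hT0.le,
        Real.rpow_neg (by norm_num), div_inv_eq_mul, mul_comm,
        show κ / 4 * -(κ / 2) = -(κ ^ 2 / 8) by ring]
      exact mul_le_mul_of_nonneg_right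
        (Real.rpow_le_self_of_one_le (by norm_num) (by linarith)) (by positivity)
    calc K * L * (X : ℝ) ^ (-(κ / 2)) ≤ T * (2 * T ^ (-(κ ^ 2 / 8))) :=
          mul_le_mul hKL h1 (by positivity) hT0.le
      _ = 2 * T ^ (1 - κ ^ 2 / 8) := by
          rw [sub_eq_add_neg, Real.rpow_add hT0, Real.rpow_one]; ring
  have hoff := rpow_mul_one_add_log_le hκ hκ'.le hT1 hY1 hYle
  have hexp : T ^ (1 - κ / 2) ≤ T ^ (1 - κ ^ 2 / 8) :=
    Real.rpow_le_rpow_of_exponent_le hT1 (by nlinarith)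
  have hoff' := hoff.trans (mul_le_mul_of_nonneg_left hexp (by positivity))
  have := mul_le_mul_of_nonneg_left (add_le_add hdiag hoff') hC₂.le
  linarith

lemma eventually_log_rpow_le (A : ℝ) {c δ : ℝ} (hc : 0 < c) (hδ : 0 < δ) :
    ∀ᶠ T : ℝ in atTop, Real.log (2 * T) ^ A ≤ c * T ^ δ := by
  have h2 : Tendsto (fun T : ℝ => 2 * T) atTop atTop := tendsto_id.const_mul_atTop two_pos
  have h := (isLittleO_log_rpow_rpow_atTop A hδ).def
    (show (0 : ℝ) < c / 2 ^ δ by positivity)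
  filter_upwards [h2.eventually h, eventually_ge_atTop 1] with T hT hT1
  have hT0 : 0 ≤ T := by linarith
  refine (Real.le_norm_self _).trans (hT.trans (le_of_eq ?_))
  rw [Real.norm_of_nonneg (by positivity), Real.mul_rpow two_pos.le hT0]
  field_simp

/-- **Existence of zero-free blocks.** Fix `1/2 < σ₁ < 1` and `A, B > 0`. For every
sufficiently large `T` there is `T' ∈ [T, 2T]` such that `ζ` has no zeros in the region
`Re s > 1/4 + σ₁/2`, `|Im s − T'| ≤ 2 + (log T')^A + 2 (log T')^B`. -/
theorem zero_free_blocks_exist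
    (σ₁ A B : ℝ) (hσ₁ : 1 / 2 < σ₁) (hσ₁' : σ₁ < 1) (hA : 0 < A) (hB : 0 < B) :
    ∀ᶠ T : ℝ in atTop, ∃ T' ∈ Set.Icc T (2 * T), ∀ s : ℂ,
      1 / 4 + σ₁ / 2 < s.re →
      |s.im - T'| ≤ 2 + Real.log T' ^ A + 2 * Real.log T' ^ B →
      riemannZeta s ≠ 0 := by
  obtain ⟨δ, C, hδ, hC, hcard⟩ := exists_card_spaced_zeros_le
    (σ₀ := 1 / 4 + σ₁ / 2) (by linarith) (by linarith)
  have hlim : Tendsto (fun T : ℝ => T ^ (min δ 1 : ℝ)) atTop atTop :=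
    tendsto_rpow_atTop (lt_min hδ one_pos)
  set c : ℝ := 1 / (32 * (C + 1)) with hc
  have hc0 : 0 < c := by positivity
  filter_upwards [hcard, eventually_ge_atTop 1,
    eventually_log_rpow_le A hc0 (lt_min hδ one_pos),
    eventually_log_rpow_le B hc0 (lt_min hδ one_pos), hlim.eventually_ge_atTop (2 / c)]
    with T hT hT1 hTA hTB hTc
  have hT0 : 0 < T := by linarith
  by_contra! hcon
  set W := 2 + Real.log (2 * T) ^ A + 2 * Real.log (2 * T) ^ B with hW
  have hl2 : 0 ≤ Real.log (2 * T) := Real.log_nonneg (by linarith)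
  have hW2 : 2 ≤ W := by
    have := Real.rpow_nonneg hl2 A
    have := Real.rpow_nonneg hl2 B
    linarith
  have hWle : W ≤ 4 * c * T ^ (min δ 1) := by
    have : 2 ≤ c * T ^ (min δ 1) := by
      rw [div_le_iff₀ hc0] at hTc
      linarith
    linarith
  have hWδ : 8 * (C + 1) * W ≤ T ^ (min δ 1) := by
    have := mul_le_mul_of_nonneg_left hWle (show 0 ≤ 8 * (C + 1) by positivity)
    refine this.trans (le_of_eq ?_)
    rw [hc]; field_simp; norm_num
  have hWT : 8 * W ≤ T := by
    have h1 : T ^ (min δ 1) ≤ T := Real.rpow_le_self_of_one_le hT1 (min_le_right _ _)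
    nlinarith
  set L := 2 * W with hL
  have hL0 : 0 < L := by linarith
  set K := ⌊T / L⌋₊ with hK
  have hKle : K * L ≤ T := by
    have := Nat.floor_le (show 0 ≤ T / L by positivity)
    rwa [le_div_iff₀ hL0] at this
  have hKge : T / (2 * L) ≤ K := by
    have h1 := Nat.lt_floor_add_one (T / L)
    have h2 : 2 ≤ T / L := by rw [le_div_iff₀ hL0]; linarith
    have h3 : T / (2 * L) = T / L / 2 := by field_simp
    rw [h3]; linarith
  have hcen : ∀ j < K, T + j * L + W ∈ Set.Icc T (2 * T) := fun j hj => by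
    have h1 : ((j + 1 : ℕ) : ℝ) * L ≤ K * L :=
      mul_le_mul_of_nonneg_right (by exact_mod_cast hj) (by linarith)
    push_cast at h1
    have h2 : 0 ≤ (j : ℝ) * L := by positivity
    exact ⟨by linarith, by linarith⟩
  have hex : ∀ j : ℕ, ∃ s : ℂ, j < K → 1 / 4 + σ₁ / 2 ≤ s.re ∧ riemannZeta s = 0 ∧
      s.im ∈ Set.Icc (T + j * L) (T + (j + 1 : ℕ) * L) := by
    intro j
    by_cases hj : j < K
    · have hm := hcen j hj
      obtain ⟨s, hs1, hs2, hs3⟩ := hcon _ hm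
      have hle : ∀ {D : ℝ}, 0 < D →
          Real.log (T + j * L + W) ^ D ≤ Real.log (2 * T) ^ D := fun hD =>
        Real.rpow_le_rpow (Real.log_nonneg (by linarith [hm.1]))
          (Real.log_le_log (by linarith [hm.1]) hm.2) hD.le
      have h4 := abs_le.1 (hs2.trans (show _ ≤ W by linarith [hle hA, hle hB]))
      refine ⟨s, fun _ => ⟨hs1.le, hs3, ?_, ?_⟩⟩
      · linarith [h4.1]
      · push_cast; linarith [h4.2]
    · exact ⟨0, fun h => absurd h hj⟩
  choose s hs using hex
  have hKC := hT L K (by linarith) hKle s fun j hj => hs j hj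
  have h1 : T / (2 * L) ≤ C * T ^ (1 - δ) := hKge.trans hKC
  rw [div_le_iff₀ (by positivity), Real.rpow_sub hT0, Real.rpow_one] at h1
  have hTδ : 0 < T ^ δ := by positivity
  have h2 : T ^ δ ≤ C * (2 * L) := by
    have e : C * (T / T ^ δ) * (2 * L) = T * (C * (2 * L)) / T ^ δ := by ring
    rw [e, le_div_iff₀ hTδ] at h1
    exact le_of_mul_le_mul_left h1 hT0
  have h3 : T ^ (min δ 1) ≤ T ^ δ := Real.rpow_le_rpow_of_exponent_le hT1 (min_le_left _ _)
  have h4 : 0 < C * W := by positivity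
  nlinarith
end

section
/- Let α_1, …, α_n be real numbers linearly independent over ℚ, and let γ ⊂ [0,1]^n be a bounded set whose topological boundary has n-dimensional Lebesgue measure zero (i.e. γ is Jordan measurable), with Lebesgue measure Γ. Let H = H(T) satisfy 0 < H ≤ T and H → ∞ as T → ∞, and set I_γ(T) = μ{τ ∈ [T, T+H] : ({τα_1}, …, {τα_n}) ∈ γ}, where {x} denotes the fractional part. Then lim_{T→∞} I_γ(T)/H = Γ. -/
open MeasureTheory Filter

open UnitAddTorus in
/-- Weyl's criterion on the torus: convergence of all Fourier coefficients implies weak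
convergence of probability measures. -/
theorem tendsto_of_forall_tendsto_integral_mFourier {d ι : Type*} [Fintype d] {L : Filter ι}
    {μ : ι → ProbabilityMeasure (UnitAddTorus d)} {μ₀ : ProbabilityMeasure (UnitAddTorus d)}
    (h : ∀ m : d → ℤ, Tendsto (fun i => ∫ x, mFourier m x ∂(μ i : Measure (UnitAddTorus d))) L
      (nhds (∫ x, mFourier m x ∂(μ₀ : Measure (UnitAddTorus d))))) :
    Tendsto μ L (nhds μ₀) := by
  refine ProbabilityMeasure.tendsto_of_tight_of_separatesPoints ℂ
    IsTightMeasureSet.of_compactSpace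
    (A := (mFourierSubalgebra d).comap (BoundedContinuousFunction.toContinuousMapStarₐ ℂ)) ?_ ?_
  · intro x y hxy
    obtain ⟨f, ⟨g, hg, rfl⟩, hf⟩ := mFourierSubalgebra_separatesPoints hxy
    exact ⟨g, ⟨g, ⟨BoundedContinuousFunction.mkOfCompact g, hg, rfl⟩, rfl⟩, hf⟩
  · intro g hg
    have hg' : (g : C(UnitAddTorus d, ℂ)) ∈ Submodule.span ℂ (Set.range (mFourier (d := d))) := by
      rw [← mFourierSubalgebra_coe]
      exact hg
    have hint (ν : ProbabilityMeasure (UnitAddTorus d)) (f : C(UnitAddTorus d, ℂ)) :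
        Integrable f (ν : Measure (UnitAddTorus d)) :=
      (BoundedContinuousFunction.mkOfCompact f).integrable _
    change Tendsto (fun i => ∫ x, (g : C(UnitAddTorus d, ℂ)) x ∂(μ i : Measure (UnitAddTorus d))) L
      (nhds (∫ x, (g : C(UnitAddTorus d, ℂ)) x ∂(μ₀ : Measure (UnitAddTorus d))))
    generalize (g : C(UnitAddTorus d, ℂ)) = f at hg'
    induction hg' using Submodule.span_induction with
    | mem f hf =>
      obtain ⟨m, rfl⟩ := hf
      exact h m
    | zero => simpa using tendsto_const_nhds
    | add f₁ f₂ _ _ h₁ h₂ =>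
      simp only [ContinuousMap.add_apply]
      rw [integral_add (hint _ _) (hint _ _)]
      refine (h₁.add h₂).congr fun i => ?_
      rw [integral_add (hint _ _) (hint _ _)]
    | smul c f _ hf =>
      simp only [ContinuousMap.smul_apply, integral_smul]
      exact hf.const_smul c

theorem mFourier_coe_real {d : Type*} [Fintype d] (m : d → ℤ) (x : d → ℝ) :
    UnitAddTorus.mFourier m (fun i => (x i : UnitAddCircle)) =
      Complex.exp (2 * Real.pi * Complex.I * (∑ i, m i * x i : ℝ)) := by
  simp only [UnitAddTorus.mFourier, ContinuousMap.coe_mk, fourier_coe_apply, ← Complex.exp_sum]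
  push_cast
  rw [Finset.mul_sum]
  congr 1
  exact Finset.sum_congr rfl fun i _ => by ring

theorem setIntegral_fourier_Icc {k : ℤ} (hk : k ≠ 0) :
    ∫ x in Set.Icc (0 : ℝ) 1, fourier k (x : UnitAddCircle) = 0 := by
  rw [integral_Icc_eq_integral_Ioc, ← intervalIntegral.integral_of_le zero_le_one]
  have hc : 2 * Real.pi * Complex.I * k ≠ 0 := by
    simp [Real.pi_ne_zero, hk]
  have : ∀ x : ℝ, fourier k (x : UnitAddCircle) = Complex.exp (2 * Real.pi * Complex.I * k * x) := by
    intro x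
    rw [fourier_coe_apply]
    simp
  simp_rw [this]
  rw [integral_exp_mul_complex hc]
  have h1 : Complex.exp (2 * Real.pi * Complex.I * k) = 1 := by
    rw [mul_comm]
    exact Complex.exp_int_mul_two_pi_mul_I k
  simp [h1]

/-- The integral of a nontrivial character over the unit cube vanishes. -/
theorem setIntegral_mFourier_unitCube {d : Type*} [Fintype d] {m : d → ℤ} (hm : m ≠ 0) :
    ∫ x in Set.univ.pi fun _ : d => Set.Icc (0 : ℝ) 1,
      UnitAddTorus.mFourier m (fun i => (x i : UnitAddCircle)) = 0 := by
  obtain ⟨i, hi⟩ := Function.ne_iff.mp hm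
  rw [volume_pi, Measure.restrict_pi_pi]
  simp only [UnitAddTorus.mFourier, ContinuousMap.coe_mk]
  rw [integral_fintype_prod_eq_prod (fun i (x : ℝ) => fourier (m i) (x : UnitAddCircle))]
  exact Finset.prod_eq_zero (Finset.mem_univ i) (setIntegral_fourier_Icc hi)

theorem tendsto_integral_exp_affine {ι : Type*} {L : Filter ι} {T H : ι → ℝ}
    (hH : Tendsto H L atTop) {c : ℝ} (hc : c ≠ 0) :
    Tendsto (fun i => ∫ s in Set.Icc (0 : ℝ) 1,
      Complex.exp (2 * Real.pi * Complex.I * ((T i + s * H i) * c : ℝ))) L (nhds 0) := by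
  have hbound : Tendsto (fun i => 2 / (2 * Real.pi * |c| * H i)) L (nhds 0) :=
    tendsto_const_nhds.div_atTop (hH.const_mul_atTop (by positivity))
  refine squeeze_zero_norm' ?_ hbound
  filter_upwards [hH.eventually_gt_atTop 0] with i hi
  have hb : 2 * Real.pi * Complex.I * (H i * c : ℝ) ≠ 0 := by
    simp [Real.pi_ne_zero, hc, hi.ne']
  have hsplit : ∀ s : ℝ, Complex.exp (2 * Real.pi * Complex.I * ((T i + s * H i) * c : ℝ)) =
      Complex.exp ((2 * Real.pi * (T i * c) : ℝ) * Complex.I) *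
        Complex.exp (2 * Real.pi * Complex.I * (H i * c : ℝ) * s) := by
    intro s
    rw [← Complex.exp_add]
    congr 1
    push_cast
    ring
  have hone : ‖Complex.exp (2 * Real.pi * Complex.I * (H i * c : ℝ))‖ = 1 := by
    rw [← Complex.norm_exp_ofReal_mul_I (2 * Real.pi * (H i * c))]
    congr 2
    push_cast
    ring
  rw [integral_Icc_eq_integral_Ioc, ← intervalIntegral.integral_of_le zero_le_one]
  simp_rw [hsplit]
  rw [intervalIntegral.integral_const_mul, integral_exp_mul_complex hb, norm_mul,
    Complex.norm_exp_ofReal_mul_I, one_mul, norm_div]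
  simp only [Complex.ofReal_one, mul_one, Complex.ofReal_zero, mul_zero, Complex.exp_zero]
  have hden : ‖2 * Real.pi * Complex.I * (H i * c : ℝ)‖ = 2 * Real.pi * |c| * H i := by
    simp [abs_of_pos hi, abs_of_pos Real.pi_pos]
    ring
  rw [hden]
  gcongr
  exact (norm_sub_le _ _).trans (by rw [hone]; norm_num)

theorem LinearIndependent.sum_intCast_mul_ne_zero {n : Type*} [Fintype n] {α : n → ℝ}
    (hα : LinearIndependent ℚ α) {m : n → ℤ} (hm : m ≠ 0) : ∑ i, m i * α i ≠ 0 := by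
  intro h
  refine hm (funext fun i => ?_)
  have := Fintype.linearIndependent_iff.mp hα (fun i => (m i : ℚ))
    (by simpa [Rat.smul_def] using h) i
  exact_mod_cast this

/-- The law of `({τα₁}, …, {ταₙ})` for `τ` uniform in `[T, T + H]`. -/
noncomputable def fractOrbitMeasure {n : Type*} (α : n → ℝ) (T H : ℝ) : Measure (n → ℝ) :=
  (volume.restrict (Set.Icc (0 : ℝ) 1)).map fun s i => Int.fract ((T + s * H) * α i)

instance isProbabilityMeasure_restrict_Icc_zero_one :
    IsProbabilityMeasure (volume.restrict (Set.Icc (0 : ℝ) 1)) :=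
  ⟨by simp⟩

instance isProbabilityMeasure_restrict_unitCube {n : Type*} [Fintype n] :
    IsProbabilityMeasure (volume.restrict (Set.univ.pi fun _ : n => Set.Icc (0 : ℝ) 1)) := by
  rw [volume_pi, Measure.restrict_pi_pi]
  infer_instance

theorem measurable_fractOrbit {n : Type*} (α : n → ℝ) (T H : ℝ) :
    Measurable fun (s : ℝ) (i : n) => Int.fract ((T + s * H) * α i) := by
  fun_prop

instance isProbabilityMeasure_fractOrbitMeasure {n : Type*} (α : n → ℝ) (T H : ℝ) :
    IsProbabilityMeasure (fractOrbitMeasure α T H) :=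
  Measure.isProbabilityMeasure_map (measurable_fractOrbit α T H).aemeasurable

theorem continuous_coe_unitAddTorus {n : Type*} :
    Continuous fun (x : n → ℝ) i => (x i : UnitAddCircle) :=
  continuous_pi fun i => (AddCircle.continuous_mk' 1).comp (continuous_apply i)

theorem isOpenMap_coe_unitAddTorus {n : Type*} [Finite n] :
    IsOpenMap fun (x : n → ℝ) i => (x i : UnitAddCircle) :=
  IsOpenMap.piMap (fun _ => QuotientAddGroup.isOpenMap_coe) (by simp)

/-- The laws of a linear flow on the torus, over long time intervals, equidistribute. -/
theorem tendsto_map_linearFlow {n ι : Type*} [Fintype n] {L : Filter ι} {T H : ι → ℝ}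
    (hH : Tendsto H L atTop) {α : n → ℝ} (hα : LinearIndependent ℚ α)
    {μ : ι → ProbabilityMeasure (UnitAddTorus n)} {μ₀ : ProbabilityMeasure (UnitAddTorus n)}
    (hμ : ∀ i, (μ i : Measure (UnitAddTorus n)) = (volume.restrict (Set.Icc (0 : ℝ) 1)).map
      fun s j => (((T i + s * H i) * α j : ℝ) : UnitAddCircle))
    (hμ₀ : (μ₀ : Measure (UnitAddTorus n)) =
      (volume.restrict (Set.univ.pi fun _ : n => Set.Icc (0 : ℝ) 1)).map
        fun x j => (x j : UnitAddCircle)) :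
    Tendsto μ L (nhds μ₀) := by
  refine tendsto_of_forall_tendsto_integral_mFourier fun m => ?_
  by_cases hm : m = 0
  · subst hm
    simpa [UnitAddTorus.mFourier_zero] using tendsto_const_nhds
  · have hflow (i : ι) : Continuous fun (s : ℝ) j =>
        (((T i + s * H i) * α j : ℝ) : UnitAddCircle) :=
      continuous_coe_unitAddTorus.comp (f := fun (s : ℝ) j => (T i + s * H i) * α j) (by fun_prop)
    rw [hμ₀, integral_map continuous_coe_unitAddTorus.measurable.aemeasurable
      (UnitAddTorus.mFourier m).continuous.aestronglyMeasurable, setIntegral_mFourier_unitCube hm]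
    refine (tendsto_integral_exp_affine (T := T) hH (hα.sum_intCast_mul_ne_zero hm)).congr
      fun i => ?_
    rw [hμ i, integral_map (hflow i).measurable.aemeasurable
      (UnitAddTorus.mFourier m).continuous.aestronglyMeasurable]
    refine integral_congr_ae (ae_of_all _ fun s => ?_)
    simp only [mFourier_coe_real]
    congr 3
    rw [Finset.mul_sum]
    exact Finset.sum_congr rfl fun j _ => by ring

theorem fract_eq_of_coe_eq_of_mem_Ioo {x y : ℝ} (hx : x ∈ Set.Ioo (0 : ℝ) 1)
    (h : (x : UnitAddCircle) = (y : UnitAddCircle)) : Int.fract y = x := by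
  rw [← AddCircle.coe_fract y, AddCircle.coe_eq_coe_iff_of_mem_Ico (a := 0)
    ⟨hx.1.le, by simpa using hx.2⟩ ⟨Int.fract_nonneg y, by simpa using Int.fract_lt_one y⟩] at h
  exact h.symm

theorem le_liminf_fractOrbitMeasure {n ι : Type*} [Fintype n] {L : Filter ι} {T H : ι → ℝ}
    (hH : Tendsto H L atTop) {α : n → ℝ} (hα : LinearIndependent ℚ α)
    {G : Set (n → ℝ)} (hG : IsOpen G) :
    volume.restrict (Set.univ.pi fun _ : n => Set.Icc (0 : ℝ) 1) G ≤
      L.liminf fun i => fractOrbitMeasure α (T i) (H i) G := by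
  have hflow (i : ι) : Measurable fun (s : ℝ) j =>
      (((T i + s * H i) * α j : ℝ) : UnitAddCircle) :=
    (continuous_coe_unitAddTorus.comp
      (f := fun (s : ℝ) j => (T i + s * H i) * α j) (by fun_prop)).measurable
  have hcoe := (continuous_coe_unitAddTorus (n := n)).measurable
  let μ : ι → ProbabilityMeasure (UnitAddTorus n) := fun i =>
    ⟨_, Measure.isProbabilityMeasure_map (μ := volume.restrict (Set.Icc (0 : ℝ) 1))
      (hflow i).aemeasurable⟩
  let μ₀ : ProbabilityMeasure (UnitAddTorus n) :=
    ⟨_, Measure.isProbabilityMeasure_map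
      (μ := volume.restrict (Set.univ.pi fun _ : n => Set.Icc (0 : ℝ) 1)) hcoe.aemeasurable⟩
  have hμ : Tendsto μ L (nhds μ₀) :=
    tendsto_map_linearFlow hH hα (fun _ => rfl) rfl
  set U : Set (n → ℝ) := G ∩ Set.univ.pi fun _ => Set.Ioo (0 : ℝ) 1 with hU_def
  have hU : IsOpen U := hG.inter (isOpen_set_pi Set.finite_univ fun _ _ => isOpen_Ioo)
  have hV := isOpenMap_coe_unitAddTorus U hU
  calc volume.restrict (Set.univ.pi fun _ : n => Set.Icc (0 : ℝ) 1) G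
      = volume.restrict (Set.univ.pi fun _ : n => Set.Icc (0 : ℝ) 1) U := by
        have hae : (Set.univ.pi fun _ : n => Set.Ioo (0 : ℝ) 1) =ᵐ[volume]
            Set.univ.pi fun _ : n => Set.Icc (0 : ℝ) 1 :=
          Measure.univ_pi_Ioo_ae_eq_Icc.trans (by rw [Set.pi_univ_Icc]; rfl)
        rw [← Measure.restrict_congr_set hae, Measure.restrict_apply hG.measurableSet,
          Measure.restrict_apply hU.measurableSet, hU_def, Set.inter_assoc, Set.inter_self]
    _ ≤ (μ₀ : Measure (UnitAddTorus n)) ((fun x i => (x i : UnitAddCircle)) '' U) := by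
        exact (measure_mono (Set.subset_preimage_image _ U)).trans_eq
          (Measure.map_apply hcoe hV.measurableSet).symm
    _ ≤ L.liminf fun i => (μ i : Measure (UnitAddTorus n))
          ((fun x i => (x i : UnitAddCircle)) '' U) :=
        ProbabilityMeasure.le_liminf_measure_open_of_tendsto hμ hV
    _ ≤ L.liminf fun i => fractOrbitMeasure α (T i) (H i) G := by
        refine liminf_le_liminf (Eventually.of_forall fun i => ?_)
        refine (Measure.map_apply (hflow i) hV.measurableSet).trans_le ?_
        rw [fractOrbitMeasure, Measure.map_apply (measurable_fractOrbit _ _ _) hG.measurableSet]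
        refine measure_mono ?_
        rintro s ⟨x, hx, hxs⟩
        have : (fun j => Int.fract ((T i + s * H i) * α j)) = x :=
          funext fun j => fract_eq_of_coe_eq_of_mem_Ioo (hx.2 j trivial) (congrFun hxs j)
        rw [Set.mem_preimage, this]
        exact hx.1

theorem volume_setOf_div_eq {n : Type*} (α : n → ℝ) {T H : ℝ} (hH : 0 < H) (γ : Set (n → ℝ)) :
    (volume {τ : ℝ | τ ∈ Set.Icc T (T + H) ∧ (fun i => Int.fract (τ * α i)) ∈ γ}).toReal / H =
      (volume.restrict (Set.Icc (0 : ℝ) 1)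
        ((fun (s : ℝ) (i : n) => Int.fract ((T + s * H) * α i)) ⁻¹' γ)).toReal := by
  rw [Measure.restrict_apply' measurableSet_Icc]
  have : ((fun (s : ℝ) (i : n) => Int.fract ((T + s * H) * α i)) ⁻¹' γ) ∩ Set.Icc (0 : ℝ) 1 =
      (H * ·) ⁻¹' ((T + ·) ⁻¹'
        {τ : ℝ | τ ∈ Set.Icc T (T + H) ∧ (fun i => Int.fract (τ * α i)) ∈ γ}) := by
    ext s
    simp only [Set.mem_inter_iff, Set.mem_preimage, Set.mem_Icc, Set.mem_ofPred_eq, mul_comm H s,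
      le_add_iff_nonneg_right, add_le_add_iff_left, mul_nonneg_iff_of_pos_right hH,
      mul_le_iff_le_one_left hH]
    exact and_comm
  rw [this, Real.volume_preimage_mul_left hH.ne', measure_preimage_add, ENNReal.toReal_mul,
    ENNReal.toReal_ofReal (abs_nonneg _), abs_of_pos (inv_pos.mpr hH), div_eq_inv_mul]

/-- **Kronecker–Weyl theorem in short intervals.** Let `α₁, …, αₙ` be real numbers linearly
independent over `ℚ`, and `γ ⊆ [0,1]ⁿ` a Jordan measurable set (boundary of Lebesgue measure
zero) of measure `Γ`. If `0 < H(T) ≤ T` and `H(T) → ∞`, then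
`μ{τ ∈ [T, T+H] : ({τα₁}, …, {ταₙ}) ∈ γ} / H → Γ` as `T → ∞`. -/
theorem kronecker_weyl_short_intervals
    (n : ℕ) (α : Fin n → ℝ) (hα : LinearIndependent ℚ α)
    (γ : Set (Fin n → ℝ)) (hγ : γ ⊆ Set.univ.pi fun _ => Set.Icc (0 : ℝ) 1)
    (hγ_jordan : volume (frontier γ) = 0)
    (H : ℝ → ℝ) (hH : ∀ᶠ T in atTop, 0 < H T ∧ H T ≤ T)
    (hH' : Tendsto H atTop atTop) :
    Tendsto (fun T : ℝ =>
        (volume {τ : ℝ | τ ∈ Set.Icc T (T + H T) ∧ (fun i => Int.fract (τ * α i)) ∈ γ}).toReal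
          / H T)
      atTop (nhds (volume γ).toReal) := by
  set ν : Measure (Fin n → ℝ) := volume.restrict (Set.univ.pi fun _ => Set.Icc (0 : ℝ) 1) with hν
  have hν_null : ν (frontier γ) = 0 :=
    le_antisymm ((Measure.restrict_apply_le _ _).trans hγ_jordan.le) zero_le
  have hlim {E : Set (Fin n → ℝ)} (hE : ν (frontier E) = 0) :
      Tendsto (fun T => (fractOrbitMeasure α T (H T) E).toReal) atTop (nhds (ν E).toReal) :=
    (ENNReal.tendsto_toReal (measure_ne_top _ _)).comp
      (tendsto_measure_of_null_frontier
        (fun G hG => le_liminf_fractOrbitMeasure (T := fun T => T) hH' hα hG) hE)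
  have hint : ν (interior γ) = ν γ := measure_congr (interior_ae_eq_of_null_frontier hν_null)
  have hcl : ν (closure γ) = ν γ := measure_congr (closure_ae_eq_of_null_frontier hν_null)
  have hνγ : ν γ = volume γ := by
    rw [hν, Measure.restrict_eq_self _ hγ]
  have hlo := hlim (measure_mono_null frontier_interior_subset hν_null)
  have hhi := hlim (measure_mono_null frontier_closure_subset hν_null)
  rw [hint, hνγ] at hlo
  rw [hcl, hνγ] at hhi
  refine tendsto_of_tendsto_of_tendsto_of_le_of_le' hlo hhi ?_ ?_
  · filter_upwards [hH] with T hT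
    rw [volume_setOf_div_eq α hT.1 γ, fractOrbitMeasure,
      Measure.map_apply (measurable_fractOrbit _ _ _) isOpen_interior.measurableSet]
    exact ENNReal.toReal_mono (measure_ne_top _ _)
      (measure_mono (Set.preimage_mono interior_subset))
  · filter_upwards [hH] with T hT
    rw [volume_setOf_div_eq α hT.1 γ, fractOrbitMeasure,
      Measure.map_apply (measurable_fractOrbit _ _ _) isClosed_closure.measurableSet]
    exact ENNReal.toReal_mono (measure_ne_top _ _)
      (measure_mono (Set.preimage_mono subset_closure))
end

section
/- Let M be a finite set of primes, (θ_p)_{p∈M} real numbers, and 0 < δ < 1. Let H = H(T) satisfy 0 < H ≤ T and H → ∞ as T → ∞, and define C(δ, M, T) = {τ ∈ [T, T+H] : ‖θ_p − τ log p/(2π)‖ < δ/2 for all p ∈ M}, where ‖x‖ denotes the distance from x to the nearest integer. Then μ(C(δ, M, T)) ∼ δ^{|M|} H as T → ∞, i.e. lim_{T→∞} μ(C(δ, M, T))/H = δ^{|M|}. -/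
open MeasureTheory Filter

/-- The logarithms of distinct primes are linearly independent over `ℤ`. -/
theorem linearIndependent_log_primes (M : Finset ℕ) (hM : ∀ p ∈ M, Nat.Prime p) :
    LinearIndependent ℤ (fun p : M => Real.log (p : ℕ)) := by
  rw [Fintype.linearIndependent_iff]
  intro n hn q
  have hpos : ∀ p : M, 0 < ((p : ℕ) : ℚ) := fun p => by exact_mod_cast (hM p p.2).pos
  have hprod : ∏ p : M, (((p : ℕ) : ℚ) ^ n p) = 1 := by
    have hreal : ∏ p : M, (((p : ℕ) : ℝ) ^ n p) = 1 := by
      have hpos' : ∀ p : M, 0 < ((p : ℕ) : ℝ) := fun p => by exact_mod_cast (hM p p.2).pos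
      refine Real.eq_one_of_pos_of_log_eq_zero
        (Finset.prod_pos fun p _ => zpow_pos (hpos' p) _) ?_
      rw [Real.log_prod fun p _ => (zpow_pos (hpos' p) _).ne']
      simpa [Real.log_zpow] using hn
    have hcast : ((∏ p : M, (((p : ℕ) : ℚ) ^ n p) : ℚ) : ℝ) = 1 := by
      push_cast
      exact hreal
    exact_mod_cast hcast
  have : Fact (Nat.Prime (q : ℕ)) := ⟨hM q q.2⟩
  have hval : ∀ S : Finset M, padicValRat (q : ℕ) (∏ p ∈ S, (((p : ℕ) : ℚ) ^ n p))
      = ∑ p ∈ S, n p * padicValRat (q : ℕ) ((p : ℕ) : ℚ) := by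
    intro S
    induction S using Finset.induction_on with
    | empty => simp
    | insert p S hp ih =>
      rw [Finset.prod_insert hp, Finset.sum_insert hp, ← ih,
        padicValRat.mul (zpow_pos (hpos p) _).ne'
          (Finset.prod_pos fun r _ => zpow_pos (hpos r) _).ne', padicValRat.zpow]
  have key := hval Finset.univ
  rw [hprod, padicValRat.one, Finset.sum_eq_single q] at key
  · rwa [padicValRat.self (hM q q.2).one_lt, mul_one, eq_comm] at key
  · intro p _ hpq
    have : padicValNat (q : ℕ) (p : ℕ) = 0 :=
      padicValNat_primes (hq := ⟨hM p p.2⟩) (fun h => hpq (Subtype.ext h.symm))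
    simp [this]
  · simp

/-- The mean of a nonconstant character over an interval tends to zero as the length of the
interval tends to infinity, uniformly in its position. -/
theorem tendsto_average_exp_zero {α : Type*} {l : Filter α} {s h : α → ℝ}
    (hh : Tendsto h l atTop) {ω : ℝ} (hω : ω ≠ 0) :
    Tendsto (fun t => (h t)⁻¹ • ∫ τ in (s t)..(s t + h t), Complex.exp (ω * Complex.I * τ)) l
      (nhds 0) := by
  have hc : (ω * Complex.I : ℂ) ≠ 0 := by simp [hω]
  have hbound : Tendsto (fun t => |(h t)⁻¹| * (2 / |ω|)) l (nhds 0) := by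
    simpa using (hh.inv_tendsto_atTop.abs.mul_const (2 / |ω|))
  refine squeeze_zero_norm (fun t => ?_) hbound
  rw [norm_smul, Real.norm_eq_abs, integral_exp_mul_complex hc, norm_div]
  have hexp : ∀ x : ℝ, ‖Complex.exp (ω * Complex.I * x)‖ = 1 := fun x => by
    rw [show (ω * Complex.I * x : ℂ) = ((ω * x : ℝ) : ℂ) * Complex.I by push_cast; ring]
    exact Complex.norm_exp_ofReal_mul_I _
  have hsub := norm_sub_le (Complex.exp (ω * Complex.I * ((s t + h t : ℝ) : ℂ)))
    (Complex.exp (ω * Complex.I * (s t : ℂ)))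
  rw [hexp, hexp] at hsub
  have hn : ‖(ω * Complex.I : ℂ)‖ = |ω| := by simp
  rw [hn]
  gcongr
  linarith

/-- The linear flow on the torus with direction `-a` starting at `θ`. -/
noncomputable def torusFlow {ι : Type*} (θ a : ι → ℝ) (τ : ℝ) : UnitAddTorus ι :=
  fun i => ((θ i - τ * a i : ℝ) : UnitAddCircle)

theorem continuous_torusFlow {ι : Type*} (θ a : ι → ℝ) : Continuous (torusFlow θ a) := by
  refine continuous_pi fun i => ?_
  exact (AddCircle.continuous_mk' 1).comp (by fun_prop : Continuous fun τ : ℝ => θ i - τ * a i)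

theorem mFourier_torusFlow {ι : Type*} [Fintype ι] (θ a : ι → ℝ) (n : ι → ℤ) (τ : ℝ) :
    UnitAddTorus.mFourier n (torusFlow θ a τ) =
      Complex.exp (2 * Real.pi * Complex.I * ∑ i, n i * θ i) *
        Complex.exp ((-(2 * Real.pi * ∑ i, n i * a i) : ℝ) * Complex.I * τ) := by
  simp only [UnitAddTorus.mFourier, ContinuousMap.coe_mk, torusFlow, fourier_coe_apply]
  rw [← Complex.exp_sum, ← Complex.exp_add]
  congr 1
  push_cast
  simp only [Finset.mul_sum, Finset.sum_mul, ← Finset.sum_neg_distrib, ← Finset.sum_add_distrib]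
  refine Finset.sum_congr rfl fun i _ => ?_
  ring

/-- The Haar probability measure on the torus. -/
noncomputable abbrev torusHaar (ι : Type*) [Fintype ι] : Measure (UnitAddTorus ι) :=
  Measure.pi fun _ => AddCircle.haarAddCircle

theorem integral_mFourier_of_ne_zero {ι : Type*} [Fintype ι] {n : ι → ℤ} (hn : n ≠ 0) :
    ∫ x, UnitAddTorus.mFourier n x ∂torusHaar ι = 0 := by
  simp only [UnitAddTorus.mFourier, ContinuousMap.coe_mk]
  rw [integral_fintype_prod_eq_prod]
  obtain ⟨i, hi⟩ := Function.ne_iff.mp hn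
  apply Finset.prod_eq_zero (Finset.mem_univ i)
  have h := (orthonormal_iff_ite.mp (orthonormal_fourier (T := 1))) 0 (n i)
  rw [if_neg (Ne.symm (by simpa using hi)), ContinuousMap.inner_toLp] at h
  simpa using h

/-- Weak convergence of probability measures on a compact space can be tested on a family of
continuous functions whose linear span is dense. -/
theorem tendsto_probabilityMeasure_of_span_dense {X α : Type*} [TopologicalSpace X]
    [CompactSpace X] [MeasurableSpace X] [OpensMeasurableSpace X]
    {l : Filter α}
    {μs : α → ProbabilityMeasure X} {μ : ProbabilityMeasure X} {S : Set C(X, ℂ)}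
    (hS : (Submodule.span ℂ S).topologicalClosure = ⊤)
    (h : ∀ f ∈ S, Tendsto (fun t => ∫ x, f x ∂(μs t : Measure X)) l
      (nhds (∫ x, f x ∂(μ : Measure X)))) :
    Tendsto μs l (nhds μ) := by
  have hint : ∀ (ν : ProbabilityMeasure X) (f : C(X, ℂ)), Integrable f (ν : Measure X) :=
    fun ν f => (BoundedContinuousFunction.mkOfCompact f).integrable _
  have hspan : ∀ f ∈ Submodule.span ℂ S, Tendsto (fun t => ∫ x, f x ∂(μs t : Measure X)) l
      (nhds (∫ x, f x ∂(μ : Measure X))) := by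
    intro f hf
    induction hf using Submodule.span_induction with
    | mem f hf => exact h f hf
    | zero => simpa using tendsto_const_nhds
    | add f g _ _ hf hg =>
      simpa only [ContinuousMap.add_apply, integral_add (hint _ f) (hint _ g)] using hf.add hg
    | smul c f _ hf =>
      simpa only [ContinuousMap.smul_apply, integral_smul] using hf.const_smul c
  rw [ProbabilityMeasure.tendsto_iff_forall_integral_rclike_tendsto ℂ]
  intro f
  have hfc : f.toContinuousMap ∈ closure (Submodule.span ℂ S : Set C(X, ℂ)) := by
    rw [← Submodule.topologicalClosure_coe, hS]
    trivial
  rw [Metric.tendsto_nhds]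
  intro ε hε
  obtain ⟨g, hg, hfg⟩ := Metric.mem_closure_iff.mp hfc (ε / 3) (by positivity)
  have hclose : ∀ ν : ProbabilityMeasure X,
      ‖∫ x, f x ∂(ν : Measure X) - ∫ x, g x ∂(ν : Measure X)‖ ≤ ε / 3 := by
    intro ν
    rw [← integral_sub (f.integrable _) (hint ν g)]
    refine (norm_integral_le_of_norm_le_const (C := ε / 3)
      (Eventually.of_forall fun x => ?_)).trans (by simp)
    rw [← dist_eq_norm]
    exact (ContinuousMap.dist_apply_le_dist (f := f.toContinuousMap) (g := g) x).trans hfg.le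
  filter_upwards [Metric.tendsto_nhds.mp (hspan g hg) (ε / 3) (by positivity)] with t ht
  have h1 := hclose (μs t)
  have h2 := hclose μ
  rw [← dist_eq_norm] at h1 h2
  rw [dist_comm] at h2
  linarith [dist_triangle4 (∫ x, f x ∂(μs t : Measure X)) (∫ x, g x ∂(μs t : Measure X))
    (∫ x, g x ∂(μ : Measure X)) (∫ x, f x ∂(μ : Measure X))]

/-- **Kronecker–Weyl**: a linear flow with rationally independent frequencies is equidistributed
in the torus along any intervals whose lengths tend to infinity. -/
theorem tendsto_volume_torusFlow {α ι : Type*} [Fintype ι] {l : Filter α} {a : ι → ℝ}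
    (ha : LinearIndependent ℤ a) (θ : ι → ℝ) {s h : α → ℝ} (hpos : ∀ t, 0 < h t)
    (hh : Tendsto h l atTop) {E : Set (UnitAddTorus ι)} (hE : MeasurableSet E)
    (hE' : torusHaar ι (frontier E) = 0) :
    Tendsto (fun t => volume.real {τ | τ ∈ Set.Icc (s t) (s t + h t) ∧ torusFlow θ a τ ∈ E} / h t)
      l (nhds ((torusHaar ι).real E)) := by
  have hvol : ∀ t, volume (Set.Icc (s t) (s t + h t)) = ENNReal.ofReal (h t) := fun t => by
    simp [Real.volume_Icc]
  have hprob : ∀ t, IsProbabilityMeasure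
      (ProbabilityTheory.cond volume (Set.Icc (s t) (s t + h t))) := fun t =>
    ProbabilityTheory.cond_isProbabilityMeasure_of_finite
      (by rw [hvol]; simpa using hpos t) (by rw [hvol]; exact ENNReal.ofReal_ne_top)
  have hmeas : Measurable (torusFlow θ a) := (continuous_torusFlow θ a).measurable
  let ν : α → ProbabilityMeasure (UnitAddTorus ι) := fun t =>
    ⟨(ProbabilityTheory.cond volume (Set.Icc (s t) (s t + h t))).map (torusFlow θ a),
      Measure.isProbabilityMeasure_map hmeas.aemeasurable⟩
  let μ : ProbabilityMeasure (UnitAddTorus ι) := ⟨torusHaar ι, inferInstance⟩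
  have hν : Tendsto ν l (nhds μ) := by
    refine tendsto_probabilityMeasure_of_span_dense UnitAddTorus.span_mFourier_closure_eq_top ?_
    rintro _ ⟨n, rfl⟩
    by_cases hn : n = 0
    · subst hn
      simpa [UnitAddTorus.mFourier_zero] using tendsto_const_nhds
    · have hω : -(2 * Real.pi * ∑ i, n i * a i) ≠ 0 := by
        have hsum : ∑ i, n i * a i ≠ 0 := fun h0 => hn <| funext <|
          Fintype.linearIndependent_iff.mp ha n (by simpa using h0)
        simpa [Real.pi_ne_zero] using hsum
      change Tendsto _ l (nhds (∫ x, UnitAddTorus.mFourier n x ∂torusHaar ι))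
      rw [integral_mFourier_of_ne_zero hn]
      have key := (tendsto_average_exp_zero (s := s) hh hω).const_mul
        (Complex.exp (2 * Real.pi * Complex.I * ∑ i, n i * θ i))
      rw [mul_zero] at key
      refine key.congr fun t => ?_
      change _ = ∫ x, UnitAddTorus.mFourier n x ∂(Measure.map (torusFlow θ a) _)
      rw [integral_map hmeas.aemeasurable (ContinuousMap.continuous _).aestronglyMeasurable]
      simp only [mFourier_torusFlow, integral_const_mul]
      rw [ProbabilityTheory.cond, integral_smul_measure, hvol, integral_Icc_eq_integral_Ioc,
        ← intervalIntegral.integral_of_le (by linarith [hpos t]), ENNReal.toReal_inv,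
        ENNReal.toReal_ofReal (hpos t).le]
  have hlim := ProbabilityMeasure.tendsto_measure_of_null_frontier_of_tendsto' hν (E := E) hE'
  refine ((ENNReal.tendsto_toReal (measure_ne_top _ _)).comp hlim).congr fun t => ?_
  change (Measure.map (torusFlow θ a) _ E).toReal = _
  rw [Measure.map_apply hmeas hE, ProbabilityTheory.cond_apply measurableSet_Icc, hvol,
    ENNReal.toReal_mul, ENNReal.toReal_inv, ENNReal.toReal_ofReal (hpos t).le, div_eq_inv_mul]
  rfl

theorem haarAddCircle_closedBall (x : UnitAddCircle) {δ : ℝ} (hδ' : δ ≤ 1) :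
    AddCircle.haarAddCircle (Metric.closedBall x (δ / 2)) = ENNReal.ofReal δ := by
  have h := AddCircle.volume_closedBall (T := 1) (x := x) (δ / 2)
  rw [AddCircle.volume_eq_smul_haarAddCircle] at h
  simpa [mul_div_cancel₀, hδ'] using h

theorem haarAddCircle_ball (x : UnitAddCircle) {δ : ℝ} (hδ' : δ ≤ 1) :
    AddCircle.haarAddCircle (Metric.ball x (δ / 2)) = ENNReal.ofReal δ := by
  rw [← haarAddCircle_closedBall x hδ']
  have h := measure_congr (AddCircle.closedBall_ae_eq_ball (T := 1) (x := x) (ε := δ / 2))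
  rw [AddCircle.volume_eq_smul_haarAddCircle] at h
  simpa using h.symm

theorem torusHaar_pi_ball {ι : Type*} [Fintype ι] {δ : ℝ} (hδ' : δ ≤ 1) :
    torusHaar ι (Set.univ.pi fun _ => Metric.ball 0 (δ / 2)) =
      ENNReal.ofReal δ ^ Fintype.card ι := by
  rw [Measure.pi_pi]
  simp [haarAddCircle_ball _ hδ']

theorem torusHaar_frontier_pi_ball {ι : Type*} [Fintype ι] {δ : ℝ} (hδ' : δ ≤ 1) :
    torusHaar ι (frontier (Set.univ.pi fun _ => Metric.ball 0 (δ / 2))) = 0 := by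
  have hopen : IsOpen (Set.univ.pi fun _ : ι => Metric.ball (0 : UnitAddCircle) (δ / 2)) :=
    isOpen_set_pi Set.finite_univ fun _ _ => Metric.isOpen_ball
  have hsub : closure (Set.univ.pi fun _ : ι => Metric.ball (0 : UnitAddCircle) (δ / 2)) ⊆
      Set.univ.pi fun _ => Metric.closedBall 0 (δ / 2) :=
    closure_minimal (Set.pi_mono fun _ _ => Metric.ball_subset_closedBall)
      (isClosed_set_pi fun _ _ => Metric.isClosed_closedBall)
  rw [hopen.frontier_eq]
  refine measure_mono_null (Set.sdiff_subset_sdiff_left hsub) ?_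
  rw [measure_sdiff (Set.pi_mono fun _ _ => Metric.ball_subset_closedBall)
    hopen.measurableSet.nullMeasurableSet (measure_ne_top _ _), torusHaar_pi_ball hδ',
    Measure.pi_pi]
  simp only [haarAddCircle_closedBall _ hδ']
  simp

/-- **Asymptotic measure of the set of good shifts.** Let `M` be a finite set of primes,
`(θ_p)` reals, `0 < δ < 1`, and `0 < H(T) ≤ T` with `H(T) → ∞`. Then the set
`C(δ, M, T) = {τ ∈ [T, T+H] : ‖θ_p − τ log p/(2π)‖ < δ/2 for all p ∈ M}` satisfies
`μ(C(δ, M, T)) ∼ δ^{|M|} H`, where `‖x‖` is the distance to the nearest integer. -/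
theorem measure_of_good_shifts
    (M : Finset ℕ) (hM : ∀ p ∈ M, Nat.Prime p) (θ : ℕ → ℝ)
    (δ : ℝ) (hδ : 0 < δ) (hδ' : δ < 1)
    (H : ℝ → ℝ) (hH : ∀ᶠ T in atTop, 0 < H T ∧ H T ≤ T)
    (hH' : Tendsto H atTop atTop) :
    Tendsto (fun T : ℝ =>
        (volume {τ : ℝ | τ ∈ Set.Icc T (T + H T) ∧ ∀ p ∈ M,
            |θ p - τ * Real.log p / (2 * Real.pi) -
              round (θ p - τ * Real.log p / (2 * Real.pi))| < δ / 2}).toReal / H T)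
      atTop (nhds (δ ^ M.card)) := by
  have hind : LinearIndependent ℤ (fun p : M => Real.log (p : ℕ) / (2 * Real.pi)) := by
    have h := linearIndependent_log_primes M hM
    rw [Fintype.linearIndependent_iff] at h ⊢
    refine fun n hn => h n ?_
    have h2 : (∑ p : M, n p • Real.log (p : ℕ)) / (2 * Real.pi) = 0 := by
      rw [← hn, Finset.sum_div]
      exact Finset.sum_congr rfl fun p _ => by simp [mul_div_assoc]
    simpa [Real.pi_ne_zero] using h2
  have hmax : Tendsto (fun T => max 1 (H T)) atTop atTop :=
    tendsto_atTop_mono (fun T => le_max_right _ _) hH'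
  have key := tendsto_volume_torusFlow hind (fun p : M => θ p) (s := id)
    (h := fun T => max 1 (H T)) (fun T => lt_max_of_lt_left one_pos) hmax
    (E := Set.univ.pi fun _ => Metric.ball 0 (δ / 2))
    (isOpen_set_pi Set.finite_univ fun _ _ => Metric.isOpen_ball).measurableSet
    (torusHaar_frontier_pi_ball hδ'.le)
  rw [Measure.real, torusHaar_pi_ball hδ'.le, ENNReal.toReal_pow, ENNReal.toReal_ofReal hδ.le,
    Fintype.card_coe] at key
  refine key.congr' ?_
  filter_upwards [hH'.eventually_ge_atTop 1] with T hT
  simp [max_eq_right hT, Measure.real, torusFlow, ← UnitAddCircle.norm_eq, mul_div_assoc]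
end
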